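/- Let {E_k}_{k∈ℕ} be a sequence of minimizing hulls of finite perimeter, all contained in a fixed ball B_R ⊂ ℝⁿ, and suppose χ_{E_k} → χ_E in L¹(ℝⁿ). Then E is a minimizing hull. -/

import Mathlib

open MeasureTheory Metric Filter Set Bornology
open scoped ENNReal NNReal symmDiff Topology RealInnerProductSpace

noncomputable section

/-- `n`-dimensional Euclidean space. -/
abbrev Eucl (n : ℕ) : Type := EuclideanSpace ℝ (Fin n)

/-- A set has `C¹` boundary: near each boundary point it is the sublevel set of a `C¹`
function with nonvanishing differential. -/
def HasC1Boundary {n : ℕ} (E : Set (Eucl n)) : Prop :=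
  ∀ x ∈ frontier E, ∃ (U : Set (Eucl n)) (f : Eucl n → ℝ),
    IsOpen U ∧ x ∈ U ∧ ContDiff ℝ 1 f ∧ (∀ y ∈ U, fderiv ℝ f y ≠ 0) ∧
    E ∩ U = {y | y ∈ U ∧ f y ≤ 0}

/-- `E` has a `C^{1,1}` boundary near the point `x`: locally it is the sublevel set of a `C¹`
function, with Lipschitz differential, and nonvanishing differential. -/
def C11At {n : ℕ} (E : Set (Eucl n)) (x : Eucl n) : Prop :=
  ∃ (U : Set (Eucl n)) (f : Eucl n → ℝ) (K : ℝ≥0),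
    IsOpen U ∧ x ∈ U ∧ ContDiff ℝ 1 f ∧ LipschitzOnWith K (fderiv ℝ f) U ∧
    (∀ y ∈ U, fderiv ℝ f y ≠ 0) ∧ E ∩ U = {y | y ∈ U ∧ f y ≤ 0}

/-- A set has `C^{1,1}` boundary. -/
def HasC11Boundary {n : ℕ} (E : Set (Eucl n)) : Prop :=
  ∀ x ∈ frontier E, C11At E x

/-- The (relative) perimeter of `E` in the open set `O`, defined à la De Giorgi as the least
`liminf` of the `(n-1)`-dimensional Hausdorff measures of the boundaries of smooth
approximations converging to `E` in `L¹(O)`. -/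
def Pe {n : ℕ} (E O : Set (Eucl n)) : ℝ≥0∞ :=
  sInf { p : ℝ≥0∞ | ∃ Ej : ℕ → Set (Eucl n),
    (∀ j, HasC1Boundary (Ej j)) ∧
    Tendsto (fun j => volume (((Ej j) ∆ E) ∩ O)) atTop (nhds 0) ∧
    p = Filter.liminf (fun j => μH[(n : ℝ) - 1] (frontier (Ej j) ∩ O)) atTop }

/-- Total perimeter. -/
def PeT {n : ℕ} (E : Set (Eucl n)) : ℝ≥0∞ := Pe E Set.univ

/-- A Caccioppoli set: measurable, with finite perimeter. -/
def IsCaccioppoli {n : ℕ} (E : Set (Eucl n)) : Prop :=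
  MeasurableSet E ∧ PeT E < ⊤

/-- A minimizing hull: `E` minimizes perimeter with respect to all sets containing it which
coincide with `E` outside a bounded set. -/
def IsMinimizingHull {n : ℕ} (E : Set (Eucl n)) : Prop :=
  ∀ F : Set (Eucl n), MeasurableSet F → E ⊆ F → IsBounded (F \ E) → PeT E ≤ PeT F

/-- Signed distance from the boundary of `F` (negative inside, positive outside). -/
def sdist {n : ℕ} (F : Set (Eucl n)) (x : Eucl n) : ℝ :=
  haveI := Classical.dec (x ∈ F)
  if x ∈ F then -infDist x (frontier F) else infDist x (frontier F)

/-- The Almgren–Taylor–Wang functional `G(E, h, F) = Pe(E) + h⁻¹ ∫_E d_{∂F}`. -/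
def Gfun {n : ℕ} (h : ℝ) (F E : Set (Eucl n)) : EReal :=
  (PeT E : EReal) + (((h⁻¹ * ∫ x in E, sdist F x) : ℝ) : EReal)

/-- `E` is a minimizer of `G(·, h, F)` among Caccioppoli sets containing `Ω` a.e. -/
def IsGMin {n : ℕ} (Ω : Set (Eucl n)) (h : ℝ) (F E : Set (Eucl n)) : Prop :=
  IsCaccioppoli E ∧ volume (Ω \ E) = 0 ∧
  ∀ E' : Set (Eucl n), IsCaccioppoli E' → volume (Ω \ E') = 0 →
    Gfun h F E ≤ Gfun h F E'

/-- `E` is the maximal minimizer of `G(·, h, F)`: it contains every other minimizer up to a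
null set. -/
def IsMaxGMin {n : ℕ} (Ω : Set (Eucl n)) (h : ℝ) (F E : Set (Eucl n)) : Prop :=
  IsGMin Ω h F E ∧ ∀ E' : Set (Eucl n), IsGMin Ω h F E' → volume (E' \ E) = 0

/-- A discrete (in time) flow with obstacle `Ω`, initial set `E₀` and time step `h`. -/
def IsDiscreteFlow {n : ℕ} (Ω E₀ : Set (Eucl n)) (h : ℝ) (E : ℕ → Set (Eucl n)) : Prop :=
  E 0 = E₀ ∧ ∀ i : ℕ, IsGMin Ω h (E i) (E (i + 1))

/-- The maximal discrete flow: each step is the maximal minimizer. -/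
def IsMaxFlow {n : ℕ} (Ω E₀ : Set (Eucl n)) (h : ℝ) (E : ℕ → Set (Eucl n)) : Prop :=
  E 0 = E₀ ∧ ∀ i : ℕ, IsMaxGMin Ω h (E i) (E (i + 1))

/-- Normalized pointwise representative of a Caccioppoli set:
`x ∈ ∂E ↔ 0 < |B_r(x) ∩ E| < ω_n rⁿ` for all `r > 0`. -/
def IsNormalized {n : ℕ} (E : Set (Eucl n)) : Prop :=
  ∀ x : Eucl n, x ∈ frontier E ↔
    ∀ r : ℝ, 0 < r → 0 < volume (E ∩ ball x r) ∧ volume (E ∩ ball x r) < volume (ball x r)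

/-- Divergence of a vector field on Euclidean space. -/
def vdiv {n : ℕ} (V : Eucl n → Eucl n) (x : Eucl n) : ℝ :=
  ∑ i : Fin n, ⟪fderiv ℝ V x (EuclideanSpace.single i (1 : ℝ)),
    EuclideanSpace.single i (1 : ℝ)⟫

/-- The unit normal field of the level sets of `f`. -/
def unitNormalField {n : ℕ} (f : Eucl n → ℝ) (x : Eucl n) : Eucl n :=
  ‖gradient f x‖⁻¹ • gradient f x

/-- `S` is, near each of its points, a smooth hypersurface with vanishing mean curvature
(the mean curvature being the divergence of the unit normal of a local level-set
representation). -/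
def IsMinimalLocally {n : ℕ} (S : Set (Eucl n)) : Prop :=
  ∀ x ∈ S, ∃ (U : Set (Eucl n)) (f : Eucl n → ℝ),
    IsOpen U ∧ x ∈ U ∧ ContDiff ℝ (⊤ : ℕ∞) f ∧ (∀ y ∈ U, gradient f y ≠ 0) ∧
    S ∩ U = {y | y ∈ U ∧ f y = 0} ∧
    ∀ y ∈ S ∩ U, vdiv (unitNormalField f) y = 0

/-- `S` is a compact smooth embedded minimal hypersurface with boundary `B`:
away from `B`, each point of `S` has a neighbourhood in which `S` is a smooth level set
whose unit normal field is divergence free (vanishing mean curvature). -/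
def IsMinimalHypersurface {n : ℕ} (S B : Set (Eucl n)) : Prop :=
  IsCompact S ∧ IsClosed B ∧ B ⊆ S ∧
  ∀ x ∈ S \ B, ∃ (U : Set (Eucl n)) (f : Eucl n → ℝ),
    IsOpen U ∧ x ∈ U ∧ ContDiff ℝ (⊤ : ℕ∞) f ∧ (∀ y ∈ U, gradient f y ≠ 0) ∧
    S ∩ U = {y | y ∈ U ∧ f y = 0} ∧
    ∀ y ∈ S ∩ U, vdiv (unitNormalField f) y = 0

/-- A global barrier: it contains every compact minimal hypersurface whose boundary it
contains. -/
def IsGlobalBarrier {n : ℕ} (Θ : Set (Eucl n)) : Prop :=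
  ∀ S B : Set (Eucl n), IsMinimalHypersurface S B → B ⊆ Θ → S ⊆ Θ

/-- The mean-convex hull: the intersection of all global barriers containing `Ω`. -/
def mcHull {n : ℕ} (Ω : Set (Eucl n)) : Set (Eucl n) :=
  ⋂₀ { Θ : Set (Eucl n) | IsGlobalBarrier Θ ∧ Ω ⊆ Θ }

/-- A closed set with `C^{1,1}` boundary is mean-convex: the mean curvature vector points
inward a.e., i.e. the divergence of the outer unit normal is nonnegative at every boundary
point where it is defined. -/
def IsMeanConvex {n : ℕ} (Ω : Set (Eucl n)) : Prop :=
  ∀ x ∈ frontier Ω, ∃ (U : Set (Eucl n)) (f : Eucl n → ℝ) (K : ℝ≥0),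
    IsOpen U ∧ x ∈ U ∧ ContDiff ℝ 1 f ∧ LipschitzOnWith K (fderiv ℝ f) U ∧
    (∀ y ∈ U, gradient f y ≠ 0) ∧ Ω ∩ U = {y | y ∈ U ∧ f y ≤ 0} ∧
    ∀ y ∈ frontier Ω ∩ U, DifferentiableAt ℝ (unitNormalField f) y →
      0 ≤ vdiv (unitNormalField f) y

/-- `‖A_{∂E}‖_{L^∞} ≤ M`: at every boundary point where the (outer unit normal) gradient of
the signed distance function is differentiable, the norm of its derivative (which realizes
the second fundamental form of `∂E`) is at most `M`. -/
def ANormLe {n : ℕ} (E : Set (Eucl n)) (M : ℝ) : Prop :=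
  ∀ x ∈ frontier E, DifferentiableAt ℝ (gradient (sdist E)) x →
    ‖fderiv ℝ (gradient (sdist E)) x‖ ≤ M

/-- `X` is an outcome `𝓔(Ω)` of the obstacle mean curvature flow construction: the
intersection over `ε` of the asymptotic limits `E^ε_{max,∞} = ⋃_{h>0} ⋂_i E^{(h),ε}_{max,i}`
of the maximal flows with obstacle `Ω_ε = {dist(·,Ω) ≤ ε}`, started from a fixed closed
convex set `E₀` compactly containing the `Ω_ε`. -/
def IsCalE {n : ℕ} (Ω X : Set (Eucl n)) : Prop :=
  ∃ (ε₀ : ℝ) (E₀ : Set (Eucl n)) (Fl : ℝ → ℝ → ℕ → Set (Eucl n)),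
    0 < ε₀ ∧ IsClosed E₀ ∧ Convex ℝ E₀ ∧ IsBounded E₀ ∧
    (∀ ε ∈ Ioo (0 : ℝ) ε₀, HasC11Boundary (cthickening ε Ω) ∧
      cthickening ε Ω ⊆ interior E₀) ∧
    (∀ ε ∈ Ioo (0 : ℝ) ε₀, ∀ h : ℝ, 0 < h → IsMaxFlow (cthickening ε Ω) E₀ h (Fl ε h)) ∧
    X = ⋂ ε ∈ Ioo (0 : ℝ) ε₀, ⋃ h ∈ Ioi (0 : ℝ), ⋂ i, Fl ε h i

theorem exists_hausdorffMeasure_eq_smul_volume (m : ℕ) :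
    ∃ c : ℝ≥0∞, c ≠ 0 ∧ c ≠ ∞ ∧ (μH[(m : ℝ)] : Measure (Eucl m)) = c • volume := by
  have : (μH[(m : ℝ)] : Measure (Eucl m)).IsAddHaarMeasure := by
    simpa using isAddHaarMeasure_hausdorffMeasure (E := Eucl m)
  refine ⟨Measure.addHaarScalarFactor (μH[(m : ℝ)] : Measure (Eucl m)) volume, ?_, by simp, ?_⟩
  · exact_mod_cast (Measure.addHaarScalarFactor_pos_of_isAddHaarMeasure _ _).ne'
  · exact Measure.isAddLeftInvariant_eq_smul _ _

/-- Orthogonal coordinates adapted to a unit vector. -/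
theorem exists_orthogonal_coordinates {m : ℕ} (e : Eucl (m + 1)) (he : ‖e‖ = 1) :
    ∃ π : Eucl (m + 1) →L[ℝ] Eucl m, (∀ x, ‖x‖ ^ 2 = ‖π x‖ ^ 2 + ⟪e, x⟫ ^ 2) ∧
      MeasurePreserving (fun x => (π x, ⟪e, x⟫)) volume (volume.prod volume) := by
  obtain ⟨b, hb⟩ := Orthonormal.exists_orthonormalBasis_extension_of_card_eq (𝕜 := ℝ)
    (E := Eucl (m + 1)) (ι := Fin (m + 1)) (by simp) (v := fun _ => e) (s := {0})
    (by rw [orthonormal_iff_ite]; rintro ⟨i, rfl⟩ ⟨j, rfl⟩; simp [he])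
  have hb0 : b 0 = e := hb 0 rfl
  have hπ : Continuous fun x : Eucl (m + 1) =>
      (WithLp.toLp 2 fun i : Fin m => ⟪b i.succ, x⟫ : Eucl m) := by fun_prop
  refine ⟨⟨⟨⟨fun x => WithLp.toLp 2 fun i => ⟪b i.succ, x⟫, fun x y => ?_⟩, fun r x => ?_⟩, hπ⟩,
    fun x => ?_, ?_⟩
  · ext i; simp [inner_add_right]
  · ext i; simp [inner_smul_right]
  · have := b.sum_sq_norm_inner_right x
    rw [Fin.sum_univ_succ, hb0] at this
    simp [EuclideanSpace.norm_sq_eq, ← this, add_comm]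
  · have h1 := b.measurePreserving_repr
    have h3 := (PiLp.volume_preserving_ofLp (Fin (m + 1))).comp h1
    have h4 := (volume_preserving_piFinSuccAbove (fun _ : Fin (m + 1) => ℝ) 0).comp h3
    have h5 := ((MeasurePreserving.id (volume : Measure ℝ)).prod
      (PiLp.volume_preserving_toLp (Fin m))).comp h4
    have h6 := Measure.measurePreserving_swap.comp h5
    convert h6 using 1
    ext x i
    · simp [OrthonormalBasis.repr_apply_apply, Fin.tail]
    · simp [OrthonormalBasis.repr_apply_apply, hb0]

/-- The set swept out by translating a small set along a unit vector lies over the projection of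
that set, so its volume is controlled by the Hausdorff measure of the set. -/
theorem mul_volume_sweep_le {m : ℕ} {c : ℝ≥0∞}
    (hc : (μH[(m : ℝ)] : Measure (Eucl m)) = c • volume) {e : Eucl (m + 1)} (he : ‖e‖ = 1)
    {S : Set (Eucl (m + 1))} {d h : ℝ} (hS : ∀ x ∈ S, ∀ y ∈ S, dist x y ≤ d) :
    c * volume {x | ∃ s ∈ Icc 0 h, x + s • e ∈ S} ≤
      ENNReal.ofReal (h + 2 * d) * μH[(m : ℝ)] S := by
  obtain rfl | ⟨p, hp⟩ := S.eq_empty_or_nonempty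
  · simp
  obtain ⟨π, hπ, hmp⟩ := exists_orthogonal_coordinates e he
  have hπe : π e = 0 := by
    have := hπ e
    rw [real_inner_self_eq_norm_sq, he] at this
    simpa using this
  have hlip : LipschitzWith 1 π := by
    refine LipschitzWith.of_dist_le_mul fun x y => ?_
    rw [dist_eq_norm, dist_eq_norm, ← map_sub, NNReal.coe_one, one_mul]
    refine le_of_sq_le_sq ?_ (norm_nonneg _)
    rw [hπ (x - y)]
    nlinarith [sq_nonneg ⟪e, x - y⟫]
  have hsub : {x | ∃ s ∈ Icc 0 h, x + s • e ∈ S} ⊆ (fun x => (π x, ⟪e, x⟫)) ⁻¹'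
      (toMeasurable volume (π '' S) ×ˢ Icc (⟪e, p⟫ - d - h) (⟪e, p⟫ + d)) := by
    rintro x ⟨s, ⟨hs0, hsh⟩, hx⟩
    refine ⟨subset_toMeasurable _ _ ⟨_, hx, by simp [hπe]⟩, ?_⟩
    have h1 : |⟪e, x + s • e⟫ - ⟪e, p⟫| ≤ d := by
      rw [← inner_sub_right]
      refine (abs_real_inner_le_norm _ _).trans ?_
      rw [he, one_mul, ← dist_eq_norm]
      exact hS _ hx _ hp
    rw [inner_add_right, inner_smul_right, real_inner_self_eq_norm_sq, he, abs_le] at h1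
    constructor <;> simp only <;> linarith
  have hvol : c * volume (π '' S) ≤ μH[(m : ℝ)] S := by
    have := hlip.hausdorffMeasure_image_le (Nat.cast_nonneg m) S
    rw [hc] at this
    simpa using this
  calc c * volume {x | ∃ s ∈ Icc 0 h, x + s • e ∈ S}
      ≤ c * (volume (π '' S) * ENNReal.ofReal (h + 2 * d)) := by
        gcongr
        refine (measure_mono hsub).trans ?_
        rw [hmp.measure_preimage ((measurableSet_toMeasurable _ _).prod
          measurableSet_Icc).nullMeasurableSet, Measure.prod_prod, measure_toMeasurable,
          Real.volume_Icc]
        ring_nf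
        rfl
    _ ≤ _ := by rw [← mul_assoc, mul_comm (ENNReal.ofReal _)]; gcongr

/-- A separable metric space has a countable measurable partition into sets of small diameter. -/
theorem exists_measurable_partition_dist_le {X : Type*} [PseudoMetricSpace X]
    [SecondCountableTopology X] [Nonempty X] [MeasurableSpace X] [OpensMeasurableSpace X]
    {d : ℝ} (hd : 0 < d) :
    ∃ S : ℕ → Set X, (∀ i, MeasurableSet (S i)) ∧ Pairwise (Function.onFun Disjoint S) ∧
      ⋃ i, S i = univ ∧ ∀ i, ∀ x ∈ S i, ∀ y ∈ S i, dist x y ≤ d := by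
  refine ⟨disjointed fun i => ball (TopologicalSpace.denseSeq X i) (d / 2),
    fun i => MeasurableSet.disjointed (fun _ => measurableSet_ball) i, disjoint_disjointed _, ?_,
    fun i x hx y hy => ?_⟩
  · rw [iUnion_disjointed, eq_univ_iff_forall]
    intro x
    obtain ⟨i, hi⟩ := (TopologicalSpace.denseRange_denseSeq X).exists_dist_lt x (half_pos hd)
    exact mem_iUnion.2 ⟨i, hi⟩
  · have hx := disjointed_subset _ i hx
    have hy := disjointed_subset _ i hy
    have := dist_triangle_right x y (TopologicalSpace.denseSeq X i)
    rw [mem_ball] at hx hy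
    linarith

/-- A preconnected set meeting both a set and its complement meets the frontier. -/
theorem IsPreconnected.inter_frontier_nonempty_of_mem {X : Type*} [TopologicalSpace X]
    {T A : Set X} (hT : IsPreconnected T) {x y : X} (hxT : x ∈ T) (hyT : y ∈ T) (hx : x ∈ A)
    (hy : y ∉ A) : (T ∩ frontier A).Nonempty := by
  by_contra hne
  have hnot : ∀ z ∈ T, z ∉ frontier A := fun z hz hzA => hne ⟨z, hz, hzA⟩
  have hmem : ∀ z ∈ T, z ∈ closure A → z ∈ interior A := fun z hz hzA => by
    by_contra hzi
    exact hnot z hz ⟨hzA, hzi⟩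
  obtain ⟨z, -, hz1, hz2⟩ := hT (interior A) (closure A)ᶜ isOpen_interior
    isClosed_closure.isOpen_compl
    (fun z hz => (em (z ∈ closure A)).imp (hmem z hz) id)
    ⟨x, hxT, hmem x hxT (subset_closure hx)⟩
    ⟨y, hyT, fun hyc => hy (interior_subset (hmem y hyT hyc))⟩
  exact hz2 (interior_subset_closure hz1)

/-- If a segment joins a point of a set to a point of its complement, it meets the frontier. -/
theorem exists_add_smul_mem_frontier {E : Type*} [NormedAddCommGroup E] [NormedSpace ℝ E]
    {A : Set E} {x e : E} {h : ℝ} (hh : 0 ≤ h) (hx : ¬(x + h • e ∈ A ↔ x ∈ A)) :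
    ∃ s ∈ Icc 0 h, x + s • e ∈ frontier A := by
  have hc : IsPreconnected ((fun s : ℝ => x + s • e) '' Icc 0 h) :=
    isPreconnected_Icc.image _ (by fun_prop)
  have h0 : x ∈ (fun s : ℝ => x + s • e) '' Icc 0 h := ⟨0, by simp [hh], by simp⟩
  have h1 : x + h • e ∈ (fun s : ℝ => x + s • e) '' Icc 0 h := ⟨h, by simp [hh], rfl⟩
  obtain ⟨_, ⟨s, hs, rfl⟩, hy⟩ : ((fun s : ℝ => x + s • e) '' Icc 0 h ∩ frontier A).Nonempty := by
    by_cases hxA : x ∈ A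
    · exact hc.inter_frontier_nonempty_of_mem h0 h1 hxA (by tauto)
    · exact hc.inter_frontier_nonempty_of_mem h1 h0 (by tauto) hxA
  exact ⟨s, hs, hy⟩

/-- Weighted bound for the set of points whose translate lies on the other side of `A`. -/
theorem mul_lintegral_translate_le {m : ℕ} {c : ℝ≥0∞}
    (hc : (μH[(m : ℝ)] : Measure (Eucl m)) = c • volume) {e : Eucl (m + 1)} (he : ‖e‖ = 1)
    {A : Set (Eucl (m + 1))} (hA : μH[(m : ℝ)] (frontier A) ≠ ∞)
    {φ : Eucl (m + 1) → ℝ≥0∞} (hφ : Measurable φ) {K : ℝ} (hK : 0 ≤ K)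
    (hφK : ∀ x y, φ x ≤ φ y + ENNReal.ofReal (K * dist x y)) {h : ℝ} (hh : 0 < h) :
    c * ∫⁻ x in {x | ¬(x + h • e ∈ A ↔ x ∈ A)}, φ x ≤
      ENNReal.ofReal h * ((∫⁻ y in frontier A, φ y ∂μH[(m : ℝ)]) +
        ENNReal.ofReal (K * h) * μH[(m : ℝ)] (frontier A)) := by
  have key : ∀ d > 0, c * ∫⁻ x in {x | ¬(x + h • e ∈ A ↔ x ∈ A)}, φ x ≤
      ENNReal.ofReal (h + 2 * d) * ((∫⁻ y in frontier A, φ y ∂μH[(m : ℝ)]) +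
        ENNReal.ofReal (K * (h + d)) * μH[(m : ℝ)] (frontier A)) := by
    intro d hd
    obtain ⟨P, hPm, hPd, hPu, hPs⟩ :=
      exists_measurable_partition_dist_le (X := Eucl (m + 1)) hd
    set S : ℕ → Set (Eucl (m + 1)) := fun i => frontier A ∩ P i with hS
    have hSm : ∀ i, MeasurableSet (S i) := fun i => isClosed_frontier.measurableSet.inter (hPm i)
    have hSd : Pairwise (Function.onFun Disjoint S) := fun i j hij =>
      (hPd hij).mono inter_subset_right inter_subset_right
    have hSu : ⋃ i, S i = frontier A := by rw [← inter_iUnion, hPu, inter_univ]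
    set T : ℕ → Set (Eucl (m + 1)) := fun i => {x | ∃ s ∈ Icc 0 h, x + s • e ∈ S i}
    set ψ : Eucl (m + 1) → ℝ≥0∞ := fun y => φ y + ENNReal.ofReal (K * (h + d)) with hψ
    have hsub : {x | ¬(x + h • e ∈ A ↔ x ∈ A)} ⊆ ⋃ i, T i := by
      intro x hx
      obtain ⟨s, hs, hxs⟩ := exists_add_smul_mem_frontier hh.le hx
      rw [← hSu] at hxs
      obtain ⟨i, hi⟩ := mem_iUnion.1 hxs
      exact mem_iUnion.2 ⟨i, s, hs, hi⟩
    have hpiece : ∀ i, c * ∫⁻ x in T i, φ x ≤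
        ENNReal.ofReal (h + 2 * d) * ∫⁻ y in S i, ψ y ∂μH[(m : ℝ)] := by
      intro i
      set M : ℝ≥0∞ := ⨅ y ∈ S i, ψ y with hM
      have h1 : ∫⁻ x in T i, φ x ≤ M * volume (T i) := by
        rw [← setLIntegral_const]
        refine setLIntegral_mono measurable_const fun x hx => ?_
        obtain ⟨s, ⟨hs0, hsh⟩, hxs⟩ := hx
        refine le_iInf₂ fun y hy => (hφK x y).trans ?_
        have hd1 : dist x y ≤ h + d := by
          refine (dist_triangle x (x + s • e) y).trans ?_
          have := hPs i _ hxs.2 _ hy.2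
          rw [dist_self_add_right, norm_smul, he, Real.norm_of_nonneg hs0]
          linarith
        simp only [hψ]
        gcongr
      have h2 : M * μH[(m : ℝ)] (S i) ≤ ∫⁻ y in S i, ψ y ∂μH[(m : ℝ)] := by
        rw [← setLIntegral_const]
        exact setLIntegral_mono' (hSm i) fun y hy => iInf₂_le y hy
      calc c * ∫⁻ x in T i, φ x ≤ c * (M * volume (T i)) := by gcongr
        _ = M * (c * volume (T i)) := by ring
        _ ≤ M * (ENNReal.ofReal (h + 2 * d) * μH[(m : ℝ)] (S i)) :=
          mul_le_mul' le_rfl <| mul_volume_sweep_le hc he fun x hx y hy =>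
            hPs i x (inter_subset_right hx) y (inter_subset_right hy)
        _ = ENNReal.ofReal (h + 2 * d) * (M * μH[(m : ℝ)] (S i)) := by ring
        _ ≤ _ := by gcongr
    calc c * ∫⁻ x in {x | ¬(x + h • e ∈ A ↔ x ∈ A)}, φ x
        ≤ c * ∑' i, ∫⁻ x in T i, φ x := by
          gcongr
          exact (lintegral_mono_set hsub).trans (lintegral_iUnion_le _ _)
      _ = ∑' i, c * ∫⁻ x in T i, φ x := ENNReal.tsum_mul_left.symm
      _ ≤ ∑' i, ENNReal.ofReal (h + 2 * d) * ∫⁻ y in S i, ψ y ∂μH[(m : ℝ)] :=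
          ENNReal.tsum_le_tsum hpiece
      _ = ENNReal.ofReal (h + 2 * d) * ∫⁻ y in frontier A, ψ y ∂μH[(m : ℝ)] := by
          rw [ENNReal.tsum_mul_left, ← lintegral_iUnion hSm hSd, hSu]
      _ = _ := by
          rw [hψ, lintegral_add_left hφ, setLIntegral_const]
  have hlim : Tendsto (fun d : ℝ => ENNReal.ofReal (h + 2 * d) *
      ((∫⁻ y in frontier A, φ y ∂μH[(m : ℝ)]) +
        ENNReal.ofReal (K * (h + d)) * μH[(m : ℝ)] (frontier A))) (𝓝[>] 0)
      (𝓝 (ENNReal.ofReal h * ((∫⁻ y in frontier A, φ y ∂μH[(m : ℝ)]) +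
        ENNReal.ofReal (K * h) * μH[(m : ℝ)] (frontier A)))) := by
    have t1 : Tendsto (fun d : ℝ => ENNReal.ofReal (h + 2 * d)) (𝓝[>] 0)
        (𝓝 (ENNReal.ofReal h)) := by
      refine ENNReal.tendsto_ofReal (tendsto_nhdsWithin_of_tendsto_nhds ?_)
      exact Continuous.tendsto' (by fun_prop) _ _ (by simp)
    have t2 : Tendsto (fun d : ℝ => ENNReal.ofReal (K * (h + d))) (𝓝[>] 0)
        (𝓝 (ENNReal.ofReal (K * h))) := by
      refine ENNReal.tendsto_ofReal (tendsto_nhdsWithin_of_tendsto_nhds ?_)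
      exact Continuous.tendsto' (by fun_prop) _ _ (by simp)
    exact ENNReal.Tendsto.mul t1 (Or.inl (by simpa using hh))
      (tendsto_const_nhds.add (ENNReal.Tendsto.mul_const t2 (Or.inr hA)))
      (Or.inr ENNReal.ofReal_ne_top)
  exact ge_of_tendsto hlim (eventually_mem_nhdsWithin.mono fun d hd => key d hd)

/-- A nonzero continuous linear functional is a multiple of the inner product with a unit vector. -/
theorem exists_unit_vector_of_functional {E : Type*} [NormedAddCommGroup E]
    [InnerProductSpace ℝ E] [CompleteSpace E] {L : E →L[ℝ] ℝ} (hL : L ≠ 0) :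
    ∃ e : E, ‖e‖ = 1 ∧ ∀ x, L x = ‖L‖ * ⟪e, x⟫ := by
  set g := (InnerProductSpace.toDual ℝ E).symm L with hg
  have hgL : ‖g‖ = ‖L‖ := LinearIsometryEquiv.norm_map _ _
  have h0 : ‖L‖ ≠ 0 := norm_ne_zero_iff.2 hL
  refine ⟨‖L‖⁻¹ • g, by rw [norm_smul, hgL, norm_inv, norm_norm, inv_mul_cancel₀ h0], fun x => ?_⟩
  rw [real_inner_smul_left, mul_inv_cancel_left₀ h0, hg, InnerProductSpace.toDual_symm_apply]

/-- The difference of two translates of a measurable set, averaged against a kernel. -/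
theorem enorm_convolution_indicator_sub_le {m : ℕ} {A : Set (Eucl (m + 1))}
    (hA : MeasurableSet A) {ρ : Eucl (m + 1) → ℝ} (hρ : Continuous ρ) (hρc : HasCompactSupport ρ)
    (x v : Eucl (m + 1)) :
    ‖(∫ y, ρ (x + v - y) * A.indicator 1 y) - ∫ y, ρ (x - y) * A.indicator 1 y‖ₑ ≤
      ∫⁻ y in {y | ¬(y + v ∈ A ↔ y ∈ A)}, ‖ρ (x - y)‖ₑ := by
  have hintegrable : ∀ z : Eucl (m + 1),
      Integrable fun y => ρ (x - y) * A.indicator (fun _ => (1 : ℝ)) (y + z) := by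
    intro z
    have h1 : Integrable fun y => ρ (x - y) :=
      (hρ.integrable_of_hasCompactSupport hρc).comp_sub_left x
    refine h1.mul_bdd (c := 1) ?_ (Eventually.of_forall fun y => ?_)
    · exact ((measurable_const.indicator hA).comp (measurable_id.add_const z)).aestronglyMeasurable
    · by_cases hy : y + z ∈ A <;> simp [hy]
  have h2 : (∫ y, ρ (x + v - y) * A.indicator 1 y) =
      ∫ y, ρ (x - y) * A.indicator (fun _ => (1 : ℝ)) (y + v) := by
    rw [← integral_add_right_eq_self (fun y => ρ (x + v - y) * A.indicator 1 y) v]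
    simp only [add_sub_add_right_eq_sub]
    rfl
  have h3 := hintegrable 0
  simp only [add_zero] at h3
  rw [h2]
  change ‖_ - ∫ y, ρ (x - y) * A.indicator (fun _ => (1 : ℝ)) y‖ₑ ≤ _
  rw [← integral_sub (hintegrable v) h3]
  refine (enorm_integral_le_lintegral_enorm _).trans ((lintegral_mono fun y => ?_).trans
    (lintegral_indicator_le _ _))
  by_cases h1 : y + v ∈ A <;> by_cases h2 : y ∈ A <;> simp [h1, h2, Set.indicator]

/-- The gradient of a mollified indicator function is controlled by the Hausdorff measure of the
frontier. -/
theorem mul_lintegral_fderiv_convolution_le {m : ℕ} {c : ℝ≥0∞} (hct : c ≠ ∞)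
    (hc : (μH[(m : ℝ)] : Measure (Eucl m)) = c • volume) {A : Set (Eucl (m + 1))}
    (hA : MeasurableSet A) (hAf : μH[(m : ℝ)] (frontier A) ≠ ∞) {ρ : Eucl (m + 1) → ℝ}
    (hρ : ContDiff ℝ 1 ρ) (hρc : HasCompactSupport ρ) (hρ1 : ∫⁻ x, ‖ρ x‖ₑ = 1)
    {w : Eucl (m + 1) → ℝ} (hw : Differentiable ℝ w)
    (hwρ : ∀ x, w x = ∫ y, ρ (x - y) * A.indicator 1 y) :
    c * ∫⁻ x, ‖fderiv ℝ w x‖ₑ ≤ μH[(m : ℝ)] (frontier A) := by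
  obtain ⟨K, hK⟩ := hρ.lipschitzWith_of_hasCompactSupport hρc one_ne_zero
  have : IsFiniteMeasure ((μH[(m : ℝ)]).restrict (frontier A)) :=
    ⟨by simpa using hAf.lt_top⟩
  have hdir : ∀ x e, ‖e‖ = 1 →
      c * ‖fderiv ℝ w x e‖ₑ ≤ ∫⁻ y in frontier A, ‖ρ (x - y)‖ₑ ∂μH[(m : ℝ)] := by
    intro x e he
    have hlim := ((hw x).hasFDerivAt.hasLineDerivAt e).tendsto_slope_zero_right
    have t1 : Tendsto (fun t : ℝ => c * ‖t⁻¹ • (w (x + t • e) - w x)‖ₑ) (𝓝[>] 0)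
        (𝓝 (c * ‖fderiv ℝ w x e‖ₑ)) :=
      ENNReal.Tendsto.const_mul ((continuous_enorm.tendsto _).comp hlim) (Or.inr hct)
    have t2 : Tendsto (fun t : ℝ => (∫⁻ y in frontier A, ‖ρ (x - y)‖ₑ ∂μH[(m : ℝ)]) +
        ENNReal.ofReal (K * t) * μH[(m : ℝ)] (frontier A)) (𝓝[>] 0)
        (𝓝 (∫⁻ y in frontier A, ‖ρ (x - y)‖ₑ ∂μH[(m : ℝ)])) := by
      have t3 : Tendsto (fun t : ℝ => ENNReal.ofReal (K * t)) (𝓝[>] 0) (𝓝 0) := by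
        rw [← ENNReal.ofReal_zero]
        refine ENNReal.tendsto_ofReal (tendsto_nhdsWithin_of_tendsto_nhds ?_)
        exact Continuous.tendsto' (by fun_prop) _ _ (by simp)
      simpa using tendsto_const_nhds.add (ENNReal.Tendsto.mul_const t3 (Or.inr hAf))
    refine le_of_tendsto_of_tendsto t1 t2 (eventually_mem_nhdsWithin.mono fun t ht => ?_)
    have ht : 0 < t := ht
    have hφ : ∀ a b, ‖ρ (x - a)‖ₑ ≤ ‖ρ (x - b)‖ₑ + ENNReal.ofReal (K * dist a b) := by
      intro a b
      rw [← ofReal_norm, ← ofReal_norm,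
        ← ENNReal.ofReal_add (norm_nonneg _) (by positivity)]
      refine ENNReal.ofReal_le_ofReal ?_
      have h1 := hK.dist_le_mul (x - a) (x - b)
      rw [dist_sub_left, dist_eq_norm] at h1
      linarith [norm_le_norm_add_norm_sub' (ρ (x - a)) (ρ (x - b))]
    have h1 := mul_lintegral_translate_le hc he hAf (φ := fun y => ‖ρ (x - y)‖ₑ)
      (hρ.continuous.comp (continuous_const.sub continuous_id)).measurable.enorm K.2 hφ ht
    have h2 := enorm_convolution_indicator_sub_le hA hρ.continuous hρc x (t • e)
    rw [← hwρ, ← hwρ] at h2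
    change c * ‖t⁻¹ • (w (x + t • e) - w x)‖ₑ ≤ _
    rw [enorm_smul, mul_left_comm, enorm_inv ht.ne', Real.enorm_eq_ofReal ht.le, mul_comm,
      ← div_eq_mul_inv]
    refine ENNReal.div_le_of_le_mul' ?_
    exact (mul_le_mul' le_rfl h2).trans h1
  have hpt : ∀ x, c * ‖fderiv ℝ w x‖ₑ ≤ ∫⁻ y in frontier A, ‖ρ (x - y)‖ₑ ∂μH[(m : ℝ)] := by
    intro x
    by_cases hL : fderiv ℝ w x = 0
    · rw [hL, ← ofReal_norm, norm_zero, ENNReal.ofReal_zero, mul_zero]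
      exact zero_le
    · obtain ⟨e, he, hLe⟩ := exists_unit_vector_of_functional hL
      have h1 := hdir x e he
      rwa [hLe e, real_inner_self_eq_norm_sq, he, one_pow, mul_one, enorm_norm] at h1
  calc c * ∫⁻ x, ‖fderiv ℝ w x‖ₑ = ∫⁻ x, c * ‖fderiv ℝ w x‖ₑ :=
        (lintegral_const_mul' _ _ hct).symm
    _ ≤ ∫⁻ x, ∫⁻ y in frontier A, ‖ρ (x - y)‖ₑ ∂μH[(m : ℝ)] := lintegral_mono hpt
    _ = ∫⁻ y in frontier A, (∫⁻ x, ‖ρ (x - y)‖ₑ) ∂μH[(m : ℝ)] := by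
        refine lintegral_lintegral_swap (Measurable.aemeasurable ?_)
        exact (hρ.continuous.comp (continuous_fst.sub continuous_snd)).measurable.enorm
    _ = μH[(m : ℝ)] (frontier A) := by
        have h1 : ∀ y, ∫⁻ x, ‖ρ (x - y)‖ₑ = 1 := fun y => by
          rw [lintegral_sub_right_eq_self (fun x => ‖ρ x‖ₑ), hρ1]
        simp [h1]

/-- Mollifying an indicator function at scale `r` changes it in `L¹` by at most `r` times the
Hausdorff measure of the frontier. -/
theorem mul_lintegral_convolution_sub_le {m : ℕ} {c : ℝ≥0∞} (hct : c ≠ ∞)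
    (hc : (μH[(m : ℝ)] : Measure (Eucl m)) = c • volume) {A : Set (Eucl (m + 1))}
    (hA : MeasurableSet A) (hAf : μH[(m : ℝ)] (frontier A) ≠ ∞) {ρ : Eucl (m + 1) → ℝ}
    (hρ : Continuous ρ) (hρc : HasCompactSupport ρ) (hρ1 : ∫⁻ x, ‖ρ x‖ₑ = 1)
    (hρi : ∫ x, ρ x = 1) {r : ℝ} (hρr : Function.support ρ ⊆ closedBall 0 r)
    {w : Eucl (m + 1) → ℝ} (hwρ : ∀ x, w x = ∫ y, ρ (x - y) * A.indicator 1 y) :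
    c * ∫⁻ x, ‖w x - A.indicator 1 x‖ₑ ≤ ENNReal.ofReal r * μH[(m : ℝ)] (frontier A) := by
  have hAm : Measurable (A.indicator (1 : Eucl (m + 1) → ℝ)) := measurable_one.indicator hA
  have hρint : Integrable ρ := hρ.integrable_of_hasCompactSupport hρc
  have hpt : ∀ x, ‖w x - A.indicator 1 x‖ₑ ≤
      ∫⁻ t, ‖ρ t‖ₑ * ‖A.indicator (1 : Eucl (m + 1) → ℝ) (x - t) - A.indicator 1 x‖ₑ := by
    intro x
    have h1 : w x = ∫ t, ρ t * A.indicator 1 (x - t) := by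
      rw [hwρ, ← integral_sub_left_eq_self (fun t => ρ t * A.indicator 1 (x - t)) volume x]
      simp
    have h2 : A.indicator (1 : Eucl (m + 1) → ℝ) x = ∫ t, ρ t * A.indicator 1 x := by
      rw [integral_mul_const, hρi, one_mul]
    rw [h1]
    nth_rw 1 [h2]
    rw [← integral_sub _ (hρint.mul_const _)]
    · refine (enorm_integral_le_lintegral_enorm _).trans_eq (lintegral_congr fun t => ?_)
      rw [← mul_sub, enorm_mul]
    · refine hρint.mul_bdd (c := 1) ?_ (Eventually.of_forall fun y => ?_)
      · exact (hAm.comp (measurable_const.sub measurable_id)).aestronglyMeasurable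
      · by_cases hy : x - y ∈ A <;> simp [hy]
  have htr : ∀ t, c * (‖ρ t‖ₑ * ∫⁻ x, ‖A.indicator (1 : Eucl (m + 1) → ℝ) (x - t) -
      A.indicator 1 x‖ₑ) ≤ ‖ρ t‖ₑ * (ENNReal.ofReal r * μH[(m : ℝ)] (frontier A)) := by
    intro t
    by_cases hρt : ρ t = 0
    · simp [hρt]
    by_cases ht : t = 0
    · simp [ht]
    have htr : ‖t‖ ≤ r := by simpa using hρr hρt
    have ht0 : 0 < ‖t‖ := norm_pos_iff.2 ht
    rw [mul_left_comm]
    refine mul_le_mul' le_rfl ?_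
    have h1 := mul_lintegral_translate_le hc (e := -(‖t‖⁻¹ • t))
      (by rw [norm_neg, norm_smul, norm_inv, norm_norm, inv_mul_cancel₀ ht0.ne']) hAf
      (φ := fun _ => 1) measurable_const le_rfl (fun _ _ => le_self_add) ht0
    simp only [zero_mul, ENNReal.ofReal_zero, add_zero, smul_neg, smul_inv_smul₀ ht0.ne',
      setLIntegral_const, one_mul, ← sub_eq_add_neg] at h1
    refine le_trans (mul_le_mul' le_rfl ?_)
      (h1.trans (mul_le_mul' (ENNReal.ofReal_le_ofReal htr) le_rfl))
    rw [← setLIntegral_one]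
    refine (lintegral_mono fun y => ?_).trans (lintegral_indicator_le _ _)
    by_cases h1 : y - t ∈ A <;> by_cases h2 : y ∈ A <;> simp [h1, h2, Set.indicator]
  calc c * ∫⁻ x, ‖w x - A.indicator 1 x‖ₑ
      ≤ c * ∫⁻ x, ∫⁻ t, ‖ρ t‖ₑ * ‖A.indicator (1 : Eucl (m + 1) → ℝ) (x - t) -
          A.indicator 1 x‖ₑ := by
        gcongr with x
        exact hpt x
    _ = c * ∫⁻ t, ∫⁻ x, ‖ρ t‖ₑ * ‖A.indicator (1 : Eucl (m + 1) → ℝ) (x - t) -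
          A.indicator 1 x‖ₑ := by
        rw [lintegral_lintegral_swap]
        refine Measurable.aemeasurable ?_
        exact (hρ.measurable.comp measurable_snd).enorm.mul
          ((hAm.comp (measurable_fst.sub measurable_snd)).sub (hAm.comp measurable_fst)).enorm
    _ = ∫⁻ t, c * (‖ρ t‖ₑ * ∫⁻ x, ‖A.indicator (1 : Eucl (m + 1) → ℝ) (x - t) -
          A.indicator 1 x‖ₑ) := by
        rw [← lintegral_const_mul' _ _ hct]
        refine lintegral_congr fun t => ?_
        rw [lintegral_const_mul' _ _ enorm_ne_top]
    _ ≤ ∫⁻ t, ‖ρ t‖ₑ * (ENNReal.ofReal r * μH[(m : ℝ)] (frontier A)) := lintegral_mono htr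
    _ = ENNReal.ofReal r * μH[(m : ℝ)] (frontier A) := by
        rw [lintegral_mul_const _ hρ.measurable.enorm, hρ1, one_mul]

/-- A set with frontier of finite Hausdorff measure is approximated by smooth functions whose
total variation is at most the (suitably normalized) measure of the frontier. -/
theorem exists_contDiff_approx_indicator {m : ℕ} {c : ℝ≥0∞} (hct : c ≠ ∞)
    (hc : (μH[(m : ℝ)] : Measure (Eucl m)) = c • volume) {A : Set (Eucl (m + 1))}
    (hA : MeasurableSet A) (hAf : μH[(m : ℝ)] (frontier A) ≠ ∞) {r : ℝ} (hr : 0 < r) :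
    ∃ w : Eucl (m + 1) → ℝ, ContDiff ℝ (⊤ : ℕ∞) w ∧
      c * ∫⁻ x, ‖fderiv ℝ w x‖ₑ ≤ μH[(m : ℝ)] (frontier A) ∧
      c * ∫⁻ x, ‖w x - A.indicator 1 x‖ₑ ≤ ENNReal.ofReal r * μH[(m : ℝ)] (frontier A) := by
  set b : ContDiffBump (0 : Eucl (m + 1)) := ⟨r / 2, r, half_pos hr, half_lt_self hr⟩ with hb
  set ρ := b.normed volume
  have hρ : ContDiff ℝ (⊤ : ℕ∞) ρ := b.contDiff_normed
  have hρc : HasCompactSupport ρ := b.hasCompactSupport_normed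
  have hρ1 : ∫⁻ x, ‖ρ x‖ₑ = 1 := by
    rw [← ENNReal.ofReal_one, ← b.integral_normed (μ := volume),
      ofReal_integral_eq_lintegral_ofReal b.integrable_normed
        (Eventually.of_forall b.nonneg_normed)]
    exact lintegral_congr fun x => Real.enorm_eq_ofReal (b.nonneg_normed x)
  have hloc : LocallyIntegrable (A.indicator (1 : Eucl (m + 1) → ℝ)) volume :=
    (locallyIntegrable_const (1 : ℝ)).indicator hA
  have hwd := hρc.contDiff_convolution_left (ContinuousLinearMap.lsmul ℝ ℝ) hρ hloc
  have hwρ : ∀ x, (convolution ρ (A.indicator (1 : Eucl (m + 1) → ℝ))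
      (ContinuousLinearMap.lsmul ℝ ℝ) volume) x = ∫ y, ρ (x - y) * A.indicator 1 y := by
    intro x
    rw [convolution_eq_swap]
    rfl
  refine ⟨_, hwd, ?_, ?_⟩
  · exact mul_lintegral_fderiv_convolution_le hct hc hA hAf (hρ.of_le (by simp)) hρc hρ1
      (hwd.differentiable (by simp)) hwρ
  · refine mul_lintegral_convolution_sub_le hct hc hA hAf hρ.continuous hρc hρ1
      b.integral_normed ?_ hwρ
    rw [b.support_normed_eq]
    exact ball_subset_closedBall

/-- Coarea inequality on a set where the function is close to a linear functional. -/
theorem exists_lintegral_level_le_of_approximatesLinearOn {m : ℕ} {c : ℝ≥0∞}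
    (hc : (μH[(m : ℝ)] : Measure (Eucl m)) = c • volume) {ε : ℝ≥0} (hε1 : ε < 1)
    {g : Eucl (m + 1) → ℝ} {L : Eucl (m + 1) →L[ℝ] ℝ} (hL : L ≠ 0) {S : Set (Eucl (m + 1))}
    (hS : MeasurableSet S) (hg : ApproximatesLinearOn g L S (ε * ‖L‖₊)) :
    ∃ k : ℝ → ℝ≥0∞, Measurable k ∧ (∀ t, μH[(m : ℝ)] ({x | g x = t} ∩ S) ≤ k t) ∧
      ∫⁻ t, k t ≤ ((1 - ε)⁻¹ ^ m * (1 + ε) : ℝ≥0) * c * (‖L‖ₑ * volume S) := by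
  obtain ⟨e, he, hLe⟩ := exists_unit_vector_of_functional hL
  obtain ⟨π, hπ, hΨ⟩ := exists_orthogonal_coordinates e he
  have hL0 : 0 < ‖L‖ := norm_pos_iff.2 hL
  have hε1' : (ε : ℝ) < 1 := hε1
  have hε0 : (0 : ℝ) ≤ ε := ε.2
  have hg' : ∀ x ∈ S, ∀ y ∈ S, |g x - g y - ‖L‖ * ⟪e, x - y⟫| ≤ ε * ‖L‖ * ‖x - y‖ := by
    intro x hx y hy
    rw [← hLe]
    simpa using hg x hx y hy
  have hanti : ∀ x ∈ S, ∀ y ∈ S, g x = g y → ‖x - y‖ ≤ ((1 - ε)⁻¹ : ℝ≥0) * ‖π x - π y‖ := by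
    intro x hx y hy hxy
    have h1 := hg' x hx y hy
    rw [hxy, sub_self, zero_sub, abs_neg, abs_mul, abs_of_pos hL0, mul_comm (ε : ℝ),
      mul_assoc] at h1
    have h2 : |⟪e, x - y⟫| ≤ ε * ‖x - y‖ := le_of_mul_le_mul_left h1 hL0
    have h3 := hπ (x - y)
    rw [map_sub] at h3
    have h4 : ⟪e, x - y⟫ ^ 2 ≤ (ε * ‖x - y‖) ^ 2 :=
      sq_le_sq' (by linarith [abs_le.1 h2]) (abs_le.1 h2).2
    have h5 : ((1 - ε) * ‖x - y‖) ^ 2 ≤ ‖π x - π y‖ ^ 2 := by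
      nlinarith [mul_nonneg (mul_nonneg hε0 (sub_nonneg.2 hε1'.le)) (sq_nonneg ‖x - y‖)]
    have h6 := abs_le_of_sq_le_sq' h5 (norm_nonneg _)
    rw [NNReal.coe_inv, NNReal.coe_sub hε1.le, NNReal.coe_one, inv_mul_eq_div,
      le_div_iff₀ (by linarith)]
    linarith [h6.2]
  have hinj : InjOn (fun x => (π x, g x)) S := by
    intro x hx y hy hxy
    simp only [Prod.mk.injEq] at hxy
    have := hanti x hx y hy hxy.2
    rw [hxy.1, sub_self, norm_zero, mul_zero] at this
    exact sub_eq_zero.1 (norm_le_zero_iff.1 this)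
  have hΨinj : Function.Injective fun x => (π x, ⟪e, x⟫) := by
    intro x y hxy
    simp only [Prod.mk.injEq] at hxy
    have := hπ (x - y)
    rw [map_sub, inner_sub_right, hxy.1, hxy.2] at this
    simpa [sub_eq_zero] using this
  have hΦS : MeasurableSet ((fun x => (π x, g x)) '' S) :=
    hS.image_of_continuousOn_injOn (π.continuous.continuousOn.prodMk hg.continuousOn) hinj
  have hΨc : Continuous fun x => (π x, ⟪e, x⟫) := by fun_prop
  have hΨS : MeasurableSet ((fun x => (π x, ⟪e, x⟫)) '' S) :=
    hS.image_of_continuousOn_injOn hΨc.continuousOn hΨinj.injOn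
  have hvol : (volume.prod volume) ((fun x => (π x, ⟪e, x⟫)) '' S) = volume S := by
    rw [← hΨ.measure_preimage hΨS.nullMeasurableSet, hΨinj.preimage_image]
  have hle : (volume.prod volume) ((fun x => (π x, g x)) '' S) ≤
      (1 + ε : ℝ≥0) * (‖L‖ₑ * volume S) := by
    rw [← hvol, Measure.prod_apply hΦS, Measure.prod_apply hΨS, ← mul_assoc,
      ← lintegral_const_mul _ (measurable_measure_prodMk_left hΨS)]
    refine lintegral_mono fun y => ?_
    set T := Prod.mk y ⁻¹' ((fun x => (π x, ⟪e, x⟫)) '' S) with hT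
    have hch : ∀ s ∈ T, ∃ x ∈ S, π x = y ∧ ⟪e, x⟫ = s := by
      rintro s ⟨x, hx, hxs⟩
      exact ⟨x, hx, congrArg Prod.fst hxs, congrArg Prod.snd hxs⟩
    choose! p hpS hpπ hpe using hch
    have hlip : LipschitzOnWith ((1 + ε) * ‖L‖₊) (fun s => g (p s)) T := by
      refine LipschitzOnWith.of_dist_le_mul fun s hs s' hs' => ?_
      have h1 := hg' _ (hpS s hs) _ (hpS s' hs')
      have h2 := hπ (p s - p s')
      rw [map_sub, hpπ s hs, hpπ s' hs', sub_self, norm_zero, inner_sub_right, hpe s hs,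
        hpe s' hs'] at h2
      have h3 : ‖p s - p s'‖ = |s - s'| := by
        rw [← abs_of_nonneg (norm_nonneg (p s - p s'))]
        exact (sq_eq_sq_iff_abs_eq_abs _ _).1 (by linarith)
      rw [inner_sub_right, hpe s hs, hpe s' hs', h3] at h1
      rw [Real.dist_eq, Real.dist_eq]
      have h4 := abs_sub_abs_le_abs_sub (g (p s) - g (p s')) (‖L‖ * (s - s'))
      rw [abs_mul, abs_of_pos hL0] at h4
      push_cast
      linarith
    have h1 := hlip.hausdorffMeasure_image_le zero_le_one
    rw [hausdorffMeasure_real, ENNReal.rpow_one, ENNReal.coe_mul] at h1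
    refine (measure_mono ?_).trans h1
    rintro t ⟨x, hx, hxt⟩
    simp only [Prod.mk.injEq] at hxt
    have hs : ⟪e, x⟫ ∈ T := ⟨x, hx, by simp [hxt.1]⟩
    refine ⟨⟪e, x⟫, hs, ?_⟩
    have : p ⟪e, x⟫ = x := hΨinj (Prod.ext_iff.2 ⟨by simp [hpπ _ hs, hxt.1], by simp [hpe _ hs]⟩)
    simp [this, hxt.2]
  refine ⟨fun t => ((1 - ε)⁻¹ : ℝ≥0) ^ m * c *
    volume ((fun y => (y, t)) ⁻¹' ((fun x => (π x, g x)) '' S)),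
    (measurable_measure_prodMk_right hΦS).const_mul _, fun t => ?_, ?_⟩
  · have hA : AntilipschitzWith (1 - ε)⁻¹
        (fun x : ({x | g x = t} ∩ S : Set (Eucl (m + 1))) => π x) := by
      refine AntilipschitzWith.of_le_mul_dist fun x y => ?_
      rw [Subtype.dist_eq, dist_eq_norm, dist_eq_norm]
      exact hanti _ x.2.2 _ y.2.2 (Eq.trans x.2.1 (Eq.symm y.2.1))
    have h1 := hA.le_hausdorffMeasure_image (Nat.cast_nonneg m) univ
    rw [← isometry_subtype_coe.hausdorffMeasure_image (Or.inl (Nat.cast_nonneg m)), image_univ,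
      Subtype.range_coe, hc, Measure.smul_apply, smul_eq_mul, ← mul_assoc,
      ENNReal.rpow_natCast] at h1
    refine h1.trans (mul_le_mul' le_rfl (measure_mono ?_))
    rintro _ ⟨x, -, rfl⟩
    exact ⟨x, x.2.2, Prod.ext rfl x.2.1⟩
  · rw [lintegral_const_mul _ (measurable_measure_prodMk_right hΦS), ← Measure.prod_apply_symm hΦS]
    refine (mul_le_mul' le_rfl hle).trans_eq ?_
    push_cast
    ring

/-- Approximate coarea inequality for `C¹` functions. -/
theorem exists_lintegral_level_le {m : ℕ} {c : ℝ≥0∞}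
    (hc : (μH[(m : ℝ)] : Measure (Eucl m)) = c • volume) {ε : ℝ≥0} (hε0 : 0 < ε) (hε1 : ε < 1)
    {g : Eucl (m + 1) → ℝ} (hg : ContDiff ℝ 1 g) {B : Set (Eucl (m + 1))}
    (hB : MeasurableSet B) :
    ∃ k : ℝ → ℝ≥0∞, Measurable k ∧
      (∀ t, μH[(m : ℝ)] ({x | g x = t} ∩ {x | fderiv ℝ g x ≠ 0} ∩ B) ≤ k t) ∧
      ∫⁻ t, k t ≤ ((1 - ε)⁻¹ ^ m * (1 + ε) * (1 - ε)⁻¹ : ℝ≥0) * c *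
        ∫⁻ x in B, ‖fderiv ℝ g x‖ₑ := by
  have hg' : Continuous (fderiv ℝ g) := hg.continuous_fderiv one_ne_zero
  set D := {x | fderiv ℝ g x ≠ 0} with hD
  rcases D.eq_empty_or_nonempty with hDe | hDn
  · exact ⟨0, measurable_zero, by simp [hDe], by simp⟩
  have hDo : IsOpen D := isOpen_ne_fun hg' continuous_const
  have hloc : ∀ x ∈ D, ∃ U, IsOpen U ∧ x ∈ U ∧
      ApproximatesLinearOn g (fderiv ℝ g x) U (ε * ‖fderiv ℝ g x‖₊) ∧
      ∀ y ∈ U, (1 - ε) * ‖fderiv ℝ g x‖₊ ≤ ‖fderiv ℝ g y‖₊ := by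
    intro x hx
    have hx0 : 0 < ‖fderiv ℝ g x‖₊ := by simpa [hD] using hx
    obtain ⟨s, hs, hsa⟩ := ((hg.contDiffAt (x := x)).hasStrictFDerivAt one_ne_zero
      ).approximates_deriv_on_nhds (Or.inr (mul_pos hε0 hx0))
    have h2 : ∀ᶠ y in 𝓝 x, (1 - ε) * ‖fderiv ℝ g x‖₊ < ‖fderiv ℝ g y‖₊ := by
      refine (tendsto_const_nhds.eventually_lt (hg'.nnnorm.tendsto x)) ?_
      have : 1 - ε < 1 := tsub_lt_self one_pos hε0
      simpa using mul_lt_mul_of_pos_right this hx0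
    obtain ⟨U, hU, hUo, hxU⟩ := _root_.mem_nhds_iff.1 (inter_mem hs h2)
    exact ⟨U, hUo, hxU, hsa.mono_set (hU.trans inter_subset_left), fun y hy => (hU hy).2.le⟩
  choose! U hUo hxU hUa hUn using hloc
  obtain ⟨t, htD, htc, htU⟩ := TopologicalSpace.countable_cover_nhdsWithin
    (s := D) (f := U) fun x hx => mem_nhdsWithin_of_mem_nhds ((hUo x hx).mem_nhds (hxU x hx))
  have htn : t.Nonempty := by
    obtain ⟨x, hx⟩ := hDn
    obtain ⟨y, hy, -⟩ := mem_iUnion₂.1 (htU hx)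
    exact ⟨y, hy⟩
  obtain ⟨f, rfl⟩ := htc.exists_eq_range htn
  have hfD : ∀ n, f n ∈ D := fun n => htD (mem_range_self n)
  set V : ℕ → Set (Eucl (m + 1)) := fun n => disjointed (fun n => U (f n)) n ∩ (D ∩ B) with hV
  have hVU : ∀ n, V n ⊆ U (f n) := fun n => inter_subset_left.trans (disjointed_subset _ n)
  have hVm : ∀ n, MeasurableSet (V n) := fun n =>
    (MeasurableSet.disjointed (fun n => (hUo _ (hfD n)).measurableSet) n).inter
      (hDo.measurableSet.inter hB)
  have hVd : Pairwise (Function.onFun Disjoint V) := fun i j hij =>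
    (disjoint_disjointed (fun n => U (f n)) hij).mono inter_subset_left inter_subset_left
  have hVun : ⋃ n, V n = D ∩ B := by
    rw [hV, ← iUnion_inter, iUnion_disjointed, inter_eq_right]
    rw [biUnion_range] at htU
    exact inter_subset_left.trans htU
  choose k hkm hkl hki using fun n => exists_lintegral_level_le_of_approximatesLinearOn hc hε1
    (hfD n) (hVm n) ((hUa _ (hfD n)).mono_set (hVU n))
  refine ⟨fun t => ∑' n, k n t, Measurable.tsum hkm, fun t => ?_, ?_⟩
  · rw [inter_assoc, ← hVun, inter_iUnion]
    exact (measure_iUnion_le _).trans (ENNReal.tsum_le_tsum fun n => hkl n t)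
  · rw [lintegral_tsum fun n => (hkm n).aemeasurable]
    calc ∑' n, ∫⁻ t, k n t
        ≤ ∑' n, ((1 - ε)⁻¹ ^ m * (1 + ε) * (1 - ε)⁻¹ : ℝ≥0) * c *
            ∫⁻ x in V n, ‖fderiv ℝ g x‖ₑ := by
          refine ENNReal.tsum_le_tsum fun n => (hki n).trans ?_
          have h1 : ‖fderiv ℝ g (f n)‖ₑ * volume (V n) ≤
              ((1 - ε)⁻¹ : ℝ≥0) * ∫⁻ x in V n, ‖fderiv ℝ g x‖ₑ := by
            rw [← lintegral_const_mul' _ _ ENNReal.coe_ne_top, ← setLIntegral_const]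
            refine setLIntegral_mono' (hVm n) fun x hx => ?_
            rw [enorm_eq_nnnorm, enorm_eq_nnnorm, ← ENNReal.coe_mul, ENNReal.coe_le_coe]
            rw [inv_mul_eq_div, le_div_iff₀ (tsub_pos_of_lt hε1), mul_comm]
            exact hUn _ (hfD n) x (hVU n hx)
          refine (mul_le_mul' le_rfl h1).trans_eq ?_
          push_cast
          ring
      _ = ((1 - ε)⁻¹ ^ m * (1 + ε) * (1 - ε)⁻¹ : ℝ≥0) * c *
            ∫⁻ x in D ∩ B, ‖fderiv ℝ g x‖ₑ := by
          rw [ENNReal.tsum_mul_left, ← hVun, lintegral_iUnion hVm hVd]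
      _ ≤ _ := mul_le_mul' le_rfl (lintegral_mono_set inter_subset_right)

/-- An arbitrarily small linear perturbation makes the set of critical points countable. -/
theorem exists_countable_critical_add_inner {n : ℕ} {u : Eucl n → ℝ} (hu : ContDiff ℝ 2 u)
    {δ : ℝ} (hδ : 0 < δ) :
    ∃ a : Eucl n, ‖a‖ < δ ∧ {x | fderiv ℝ (fun x => u x + ⟪a, x⟫) x = 0}.Countable := by
  set Θ : Eucl n → Eucl n := fun x => (InnerProductSpace.toDual ℝ (Eucl n)).symm (fderiv ℝ u x)
  have hΘ : Differentiable ℝ Θ := by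
    have h1 : ContDiff ℝ 1 (fderiv ℝ u) := hu.fderiv_right (by norm_num)
    have h2 := ((InnerProductSpace.toDual ℝ (Eucl n)).symm.contDiff (n := 1)).comp h1
    exact h2.differentiable one_ne_zero
  have hsard := addHaar_image_eq_zero_of_det_fderivWithin_eq_zero
    (volume : Measure (Eucl n)) (f := Θ) (f' := fderiv ℝ Θ) (s := {x | (fderiv ℝ Θ x).det = 0})
    (fun x _ => (hΘ x).hasFDerivAt.hasFDerivWithinAt) fun x hx => hx
  obtain ⟨b, hb, hbN⟩ : ∃ b ∈ ball (0 : Eucl n) δ, b ∉ Θ '' {x | (fderiv ℝ Θ x).det = 0} := by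
    by_contra! h
    exact (measure_ball_pos volume (0 : Eucl n) hδ).ne' (measure_mono_null h hsard)
  refine ⟨-b, by simpa using hb, ?_⟩
  set Z := {x | fderiv ℝ (fun x => u x + ⟪-b, x⟫) x = 0} with hZ
  have hZΘ : ∀ x, x ∈ Z ↔ Θ x = b := by
    intro x
    have h1 : HasFDerivAt (fun x => u x + ⟪-b, x⟫) (fderiv ℝ u x + innerSL ℝ (-b)) x :=
      ((hu.differentiable two_ne_zero) x).hasFDerivAt.add (innerSL ℝ (-b)).hasFDerivAt
    have h2 : innerSL ℝ (-b) = -(InnerProductSpace.toDual ℝ (Eucl n) b) := by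
      ext y; simp
    rw [hZ, mem_ofPred_eq, h1.fderiv, h2, ← sub_eq_add_neg, sub_eq_zero,
      ← LinearIsometryEquiv.symm_apply_eq]
  have hiso : ∀ x ∈ Z, {z | z = x ∨ Θ z ≠ b} ∈ 𝓝[Z] x := by
    intro x hx
    have hdet : (fderiv ℝ Θ x).det ≠ 0 := fun h => hbN ⟨x, h, (hZΘ x).1 hx⟩
    have h1 := (hΘ x).hasFDerivAt.eventually_ne (c := b)
      ⟨_, ((fderiv ℝ Θ x).toContinuousLinearEquivOfDetNeZero hdet).antilipschitz⟩
    refine mem_nhdsWithin_of_mem_nhds ?_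
    filter_upwards [eventually_nhdsWithin_iff.1 h1] with z hz
    exact or_iff_not_imp_left.2 hz
  obtain ⟨t, -, htc, ht⟩ := TopologicalSpace.countable_cover_nhdsWithin hiso
  refine htc.mono fun z hz => ?_
  obtain ⟨x, hx, rfl | hne⟩ := mem_iUnion₂.1 (ht hz)
  · exact hx
  · exact absurd ((hZΘ z).1 hz) hne

/-- The superlevel sets of `g` which stay away from the boundary of a ball have `C¹` boundary
contained in the level set, provided the level is regular. -/
theorem hasC1Boundary_superlevel {n : ℕ} {g : Eucl n → ℝ} (hg : ContDiff ℝ 1 g) {R R' t : ℝ}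
    (hRR' : R < R') (hout : ∀ x ∈ ball (0 : Eucl n) R', t ≤ g x → x ∈ closedBall 0 R)
    (hreg : ∀ x, g x = t → fderiv ℝ g x ≠ 0) :
    HasC1Boundary (ball 0 R' ∩ {x | t ≤ g x}) ∧
      frontier (ball 0 R' ∩ {x | t ≤ g x}) ⊆
        {x | g x = t} ∩ {x | fderiv ℝ g x ≠ 0} ∩ ball 0 R' := by
  set C := ball (0 : Eucl n) R' ∩ {x | t ≤ g x} with hC
  have hCeq : C = closedBall 0 R ∩ {x | t ≤ g x} := by
    refine Subset.antisymm (fun x hx => ⟨hout x hx.1 hx.2, hx.2⟩) fun x hx => ⟨?_, hx.2⟩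
    exact closedBall_subset_ball hRR' hx.1
  have hCc : IsClosed C := by
    rw [hCeq]
    exact isClosed_closedBall.inter (isClosed_le continuous_const hg.continuous)
  have hfr : frontier C ⊆ {x | g x = t} ∩ {x | fderiv ℝ g x ≠ 0} ∩ ball 0 R' := by
    intro x hx
    rw [hCc.frontier_eq] at hx
    have hxt : g x = t := by
      refine le_antisymm (not_lt.1 fun h => hx.2 ?_) hx.1.2
      refine mem_interior.2 ⟨ball 0 R' ∩ {x | t < g x}, ?_,
        isOpen_ball.inter (isOpen_lt continuous_const hg.continuous), hx.1.1, h⟩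
      exact inter_subset_inter_right _ fun y (hy : t < g y) => hy.le
    exact ⟨⟨hxt, hreg x hxt⟩, hx.1.1⟩
  refine ⟨fun x hx => ⟨ball 0 R' ∩ {x | fderiv ℝ g x ≠ 0}, fun x => t - g x, ?_, ?_, ?_, ?_, ?_⟩,
    hfr⟩
  · exact isOpen_ball.inter
      (isOpen_ne_fun (hg.continuous_fderiv one_ne_zero) continuous_const)
  · exact ⟨(hfr hx).2, (hfr hx).1.2⟩
  · exact contDiff_const.sub hg
  · intro y hy
    rw [fderiv_const_sub]
    exact neg_ne_zero.2 hy.2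
  · ext y
    simp only [hC, mem_inter_iff, mem_ofPred_eq, sub_nonpos]
    tauto

/-- A smooth function close to the indicator of a set yields a set with `C¹` boundary close to
it, whose boundary area is controlled by the total variation of the function. -/
theorem exists_hasC1Boundary_of_approx {m : ℕ} {c : ℝ≥0∞}
    (hc : (μH[(m : ℝ)] : Measure (Eucl m)) = c • volume) {u : Eucl (m + 1) → ℝ}
    (hu : ContDiff ℝ 2 u) {R : ℝ} (huR : ∀ x, x ∉ closedBall (0 : Eucl (m + 1)) R → u x = 0)
    {E : Set (Eucl (m + 1))} (hE : MeasurableSet E) (hER : E ⊆ ball 0 R) {τ : ℝ}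
    (hτ0 : 0 < τ) (hτ1 : τ < 1 / 2) :
    ∃ C : Set (Eucl (m + 1)), HasC1Boundary C ∧
      ENNReal.ofReal (τ / 2) * volume (C ∆ E) ≤ ∫⁻ x, ‖u x - E.indicator 1 x‖ₑ ∧
      ENNReal.ofReal (1 - 2 * τ) * μH[(m : ℝ)] (frontier C) ≤
        ENNReal.ofReal (1 + τ) * c * ((∫⁻ x, ‖fderiv ℝ u x‖ₑ) + ENNReal.ofReal τ) := by
  set B := ball (0 : Eucl (m + 1)) (R + 1) with hB
  obtain ⟨δ, hδ0, hδ1, hδ2⟩ : ∃ δ : ℝ, 0 < δ ∧ δ * (R + 1) ≤ τ / 2 ∧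
      ENNReal.ofReal δ * volume B ≤ ENNReal.ofReal τ := by
    have hV : volume B ≠ ∞ := measure_ball_lt_top.ne
    set v := (volume B).toReal with hv
    have hv0 : 0 ≤ v := ENNReal.toReal_nonneg
    refine ⟨min (τ / 2 / (|R| + 1)) (τ / (v + 1)), by positivity, ?_, ?_⟩
    · calc min (τ / 2 / (|R| + 1)) (τ / (v + 1)) * (R + 1)
          ≤ min (τ / 2 / (|R| + 1)) (τ / (v + 1)) * (|R| + 1) := by
            gcongr
            exact le_abs_self R
        _ ≤ τ / 2 / (|R| + 1) * (|R| + 1) := by gcongr; exact min_le_left _ _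
        _ = τ / 2 := by field_simp
    · rw [← ENNReal.ofReal_toReal hV, ← ENNReal.ofReal_mul (by positivity)]
      refine ENNReal.ofReal_le_ofReal ?_
      calc min (τ / 2 / (|R| + 1)) (τ / (v + 1)) * v
          ≤ τ / (v + 1) * (v + 1) := by
            gcongr
            · exact min_le_right _ _
            · linarith
        _ = τ := by field_simp
  obtain ⟨a, haδ, hZ⟩ := exists_countable_critical_add_inner hu hδ0
  set g : Eucl (m + 1) → ℝ := fun x => u x + ⟪a, x⟫ with hg
  have hgd : ContDiff ℝ 1 g := (hu.of_le one_le_two).add (innerSL ℝ a).contDiff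
  have hgu : ∀ x, ‖fderiv ℝ g x‖ₑ ≤ ‖fderiv ℝ u x‖ₑ + ENNReal.ofReal δ := by
    intro x
    have h1 : HasFDerivAt g (fderiv ℝ u x + innerSL ℝ a) x :=
      ((hu.differentiable two_ne_zero) x).hasFDerivAt.add (innerSL ℝ a).hasFDerivAt
    rw [h1.fderiv, ← ofReal_norm, ← ofReal_norm, ← ENNReal.ofReal_add (norm_nonneg _) hδ0.le]
    refine ENNReal.ofReal_le_ofReal ((norm_add_le _ _).trans ?_)
    rw [innerSL_apply_norm]
    linarith
  have haB : ∀ x ∈ B, |⟪a, x⟫| ≤ τ / 2 := by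
    intro x hx
    refine (abs_real_inner_le_norm a x).trans (le_trans ?_ hδ1)
    have : ‖x‖ < R + 1 := by simpa [hB] using hx
    gcongr
  obtain ⟨ε, hε0, hε1, hε⟩ : ∃ ε : ℝ≥0, 0 < ε ∧ ε < 1 ∧
      (((1 - ε)⁻¹ ^ m * (1 + ε) * (1 - ε)⁻¹ : ℝ≥0) : ℝ≥0∞) ≤ ENNReal.ofReal (1 + τ) := by
    have h1 : Tendsto (fun ε : ℝ≥0 => (1 - ε)⁻¹ ^ m * (1 + ε) * (1 - ε)⁻¹) (𝓝 0)
        (𝓝 ((1 - 0)⁻¹ ^ m * (1 + 0) * (1 - 0)⁻¹)) := by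
      have h2 : Tendsto (fun ε : ℝ≥0 => (1 - ε)⁻¹) (𝓝 0) (𝓝 (1 - 0)⁻¹) :=
        ((continuous_const.sub continuous_id).tendsto 0).inv₀ (by simp)
      exact ((h2.pow m).mul ((continuous_const.add continuous_id).tendsto 0)).mul h2
    have h3 : (1 - 0 : ℝ≥0)⁻¹ ^ m * (1 + 0) * (1 - 0)⁻¹ < (1 + τ).toNNReal := by
      simpa [Real.lt_toNNReal_iff_coe_lt] using hτ0
    have h4 := (h1.eventually_lt_const h3).and (eventually_lt_nhds one_pos)
    obtain ⟨ε, ⟨h5, h6⟩, h7⟩ :=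
      ((h4.filter_mono (nhdsWithin_le_nhds (s := Ioi 0))).and self_mem_nhdsWithin).exists
    exact ⟨ε, h7, h6, ENNReal.coe_le_coe.2 h5.le⟩
  obtain ⟨k, hkm, hkl, hki⟩ := exists_lintegral_level_le hc hε0 hε1 hgd
    (measurableSet_ball : MeasurableSet B)
  set Z := {x | fderiv ℝ g x = 0} with hZdef
  have hI : volume (Ioo τ (1 - τ)) = ENNReal.ofReal (1 - 2 * τ) := by
    rw [Real.volume_Ioo]; congr 1; ring
  have hI0 : ENNReal.ofReal (1 - 2 * τ) ≠ 0 := by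
    rw [Ne, ENNReal.ofReal_eq_zero]; linarith
  have hN : volume.restrict (Ioo τ (1 - τ)) (g '' Z ∪ (Ioo τ (1 - τ))ᶜ) = 0 := by
    refine measure_union_null ?_ ?_
    · exact Measure.absolutelyContinuous_of_le Measure.restrict_le_self
        ((hZ.image g).measure_zero volume)
    · rw [Measure.restrict_apply measurableSet_Ioo.compl, compl_inter_self, measure_empty]
  obtain ⟨t, htN, htk⟩ := exists_notMem_null_le_laverage
    (μ := volume.restrict (Ioo τ (1 - τ))) (by
      rw [Ne, Measure.restrict_eq_zero, hI]; exact hI0) hkm.aemeasurable hN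
  rw [mem_union, not_or, mem_compl_iff, not_not] at htN
  obtain ⟨htZ, htI⟩ := htN
  rw [laverage_eq, Measure.restrict_apply_univ, hI] at htk
  obtain ⟨hC1, hCf⟩ := hasC1Boundary_superlevel (R := R) (R' := R + 1) (t := t) hgd (by linarith)
    (fun x hx hxt => by
      by_contra hxR
      have h1 := (abs_le.1 (haB x hx)).2
      simp only [hg, huR x hxR] at hxt
      linarith [htI.1]) (fun x hx h0 => htZ ⟨x, h0, hx⟩)
  refine ⟨_, hC1, ?_, ?_⟩
  · refine le_trans ?_ (mul_meas_ge_le_lintegral₀ (f := fun x => ‖u x - E.indicator 1 x‖ₑ)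
      ?_ (ENNReal.ofReal (τ / 2)))
    · refine mul_le_mul' le_rfl (measure_mono fun x hx => ?_)
      rw [mem_ofPred_eq, ← ofReal_norm, Real.norm_eq_abs]
      refine ENNReal.ofReal_le_ofReal ?_
      rcases hx with ⟨⟨hxB, hxt⟩, hxE⟩ | ⟨hxE, hxC⟩
      · have h1 := (abs_le.1 (haB x hxB)).2
        simp only [hg, mem_ofPred_eq] at hxt
        rw [indicator_of_notMem hxE, le_abs]
        left
        linarith [htI.1]
      · have hxB : x ∈ B := ball_subset_ball (by linarith) (hER hxE)
        have h1 := (abs_le.1 (haB x hxB)).1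
        have hxt : g x < t := not_le.1 fun h => hxC ⟨hxB, h⟩
        simp only [hg] at hxt
        rw [indicator_of_mem hxE, Pi.one_apply, le_abs]
        right
        linarith [htI.2]
    · exact (hu.continuous.measurable.sub (measurable_one.indicator hE)).enorm.aemeasurable
  · calc ENNReal.ofReal (1 - 2 * τ) * μH[(m : ℝ)] (frontier (ball 0 (R + 1) ∩ {x | t ≤ g x}))
        ≤ ENNReal.ofReal (1 - 2 * τ) *
            ((∫⁻ t in Ioo τ (1 - τ), k t) / ENNReal.ofReal (1 - 2 * τ)) :=
          mul_le_mul' le_rfl (((measure_mono hCf).trans (hkl t)).trans htk)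
      _ = ∫⁻ t in Ioo τ (1 - τ), k t := ENNReal.mul_div_cancel hI0 ENNReal.ofReal_ne_top
      _ ≤ ∫⁻ t, k t := setLIntegral_le_lintegral _ _
      _ ≤ _ := hki
      _ ≤ ENNReal.ofReal (1 + τ) * c * ((∫⁻ x, ‖fderiv ℝ u x‖ₑ) + ENNReal.ofReal τ) := by
          refine mul_le_mul' (mul_le_mul' hε le_rfl) ?_
          calc ∫⁻ x in B, ‖fderiv ℝ g x‖ₑ ≤ ∫⁻ x in B, (‖fderiv ℝ u x‖ₑ + ENNReal.ofReal δ) :=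
                lintegral_mono fun x => hgu x
            _ = (∫⁻ x in B, ‖fderiv ℝ u x‖ₑ) + ENNReal.ofReal δ * volume B := by
                rw [lintegral_add_right _ measurable_const, setLIntegral_const]
            _ ≤ _ := add_le_add (setLIntegral_le_lintegral _ _) hδ2

theorem HasC1Boundary.isClosed {n : ℕ} {A : Set (Eucl n)} (hA : HasC1Boundary A) : IsClosed A := by
  refine isClosed_of_closure_subset fun x hx => ?_
  by_contra hxA
  have hxf : x ∈ frontier A := ⟨hx, fun h => hxA (interior_subset h)⟩
  obtain ⟨U, f, hU, hxU, hf, -, hAU⟩ := hA x hxf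
  have h1 : x ∈ closure (A ∩ U) := by
    rw [inter_comm]
    exact hU.inter_closure ⟨hxU, hx⟩
  have h2 : A ∩ U ⊆ {y | f y ≤ 0} := hAU.le.trans fun y hy => hy.2
  have h3 : f x ≤ 0 :=
    (isClosed_le hf.continuous continuous_const).closure_subset_iff.2 h2 h1
  exact hxA (hAU.ge ⟨hxU, h3⟩).1

theorem PeT_le_liminf {n : ℕ} {E : Set (Eucl n)} {A : ℕ → Set (Eucl n)}
    (hA : ∀ j, HasC1Boundary (A j))
    (hAE : Tendsto (fun j => volume (A j ∆ E)) atTop (𝓝 0)) :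
    PeT E ≤ liminf (fun j => μH[(n : ℝ) - 1] (frontier (A j))) atTop :=
  sInf_le ⟨A, hA, by simpa using hAE, by simp⟩

/-- A set of finite perimeter has approximations by sets with `C¹` boundary which almost realize
the perimeter. -/
theorem exists_hasC1Boundary_le_PeT_add {n : ℕ} {E : Set (Eucl n)} (hE : PeT E ≠ ∞) {ε : ℝ≥0∞}
    (hε : ε ≠ 0) :
    ∃ A : Set (Eucl n), HasC1Boundary A ∧ volume (A ∆ E) ≤ ε ∧
      μH[(n : ℝ) - 1] (frontier A) ≤ PeT E + ε := by
  obtain ⟨p, ⟨A, hA, hAE, rfl⟩, hlt⟩ := sInf_lt_iff.1 (ENNReal.lt_add_right hE hε)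
  simp only [inter_univ] at hAE
  obtain ⟨j, hj1, hj2⟩ := ((frequently_lt_of_liminf_lt (by isBoundedDefault) hlt).and_eventually
    (hAE.eventually_le_const hε.bot_lt)).exists
  refine ⟨A j, hA j, hj2, ?_⟩
  rw [← inter_univ (frontier (A j))]
  exact hj1.le

/-- A bounded set of finite perimeter is approximated by smooth functions which almost realize
the perimeter. -/
theorem exists_contDiff_approx_of_PeT {m : ℕ} {c : ℝ≥0∞} (hc0 : c ≠ 0) (hct : c ≠ ∞)
    (hc : (μH[(m : ℝ)] : Measure (Eucl m)) = c • volume) {E : Set (Eucl (m + 1))}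
    (hE : PeT E ≠ ∞) {ε : ℝ≥0∞} (hε : ε ≠ 0) (hεt : ε ≠ ∞) :
    ∃ w : Eucl (m + 1) → ℝ, ContDiff ℝ (⊤ : ℕ∞) w ∧ c * ∫⁻ x, ‖fderiv ℝ w x‖ₑ ≤ PeT E + ε ∧
      ∫⁻ x, ‖w x - E.indicator 1 x‖ₑ ≤ ε := by
  have hε2 : ε / 2 ≠ 0 := by simpa using hε
  obtain ⟨A, hA, hAE, hAP⟩ := exists_hasC1Boundary_le_PeT_add hE hε2
  have hAP' : μH[(m : ℝ)] (frontier A) ≤ PeT E + ε / 2 := by simpa using hAP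
  have hAf : μH[(m : ℝ)] (frontier A) ≠ ∞ :=
    ne_top_of_le_ne_top (ENNReal.add_ne_top.2 ⟨hE, ENNReal.div_ne_top hεt two_ne_zero⟩) hAP'
  obtain ⟨r, hr0, hr⟩ := ENNReal.exists_nnreal_pos_mul_lt hAf
    (mul_ne_zero hc0 hε2)
  obtain ⟨w, hw, hw1, hw2⟩ := exists_contDiff_approx_indicator hct hc hA.isClosed.measurableSet
    hAf (NNReal.coe_pos.2 hr0)
  refine ⟨w, hw, hw1.trans (hAP'.trans (add_le_add le_rfl ENNReal.half_le_self)), ?_⟩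
  have hw3 : ∫⁻ x, ‖w x - A.indicator 1 x‖ₑ ≤ ε / 2 := by
    rw [ENNReal.ofReal_coe_nnreal] at hw2
    exact (ENNReal.mul_le_mul_iff_right hc0 hct).1 (hw2.trans hr.le)
  have hAE' : ∫⁻ x, ‖A.indicator (1 : Eucl (m + 1) → ℝ) x - E.indicator 1 x‖ₑ ≤ ε / 2 := by
    refine le_trans ?_ hAE
    rw [← setLIntegral_one]
    refine (lintegral_mono fun y => ?_).trans (lintegral_indicator_le _ _)
    by_cases h1 : y ∈ A <;> by_cases h2 : y ∈ E <;> simp [h1, h2, Set.indicator, mem_symmDiff]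
  calc ∫⁻ x, ‖w x - E.indicator 1 x‖ₑ
      ≤ ∫⁻ x, (‖w x - A.indicator 1 x‖ₑ +
          ‖A.indicator (1 : Eucl (m + 1) → ℝ) x - E.indicator 1 x‖ₑ) := by
        refine lintegral_mono fun x => ?_
        rw [← sub_add_sub_cancel (w x) (A.indicator 1 x)]
        exact enorm_add_le _ _
    _ = (∫⁻ x, ‖w x - A.indicator 1 x‖ₑ) +
          ∫⁻ x, ‖A.indicator (1 : Eucl (m + 1) → ℝ) x - E.indicator 1 x‖ₑ :=
        lintegral_add_left
          (hw.continuous.measurable.sub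
            (measurable_one.indicator hA.isClosed.measurableSet)).enorm _
    _ ≤ ε / 2 + ε / 2 := add_le_add hw3 hAE'
    _ = ε := ENNReal.add_halves ε

/-- A bounded set of finite perimeter is approximated by smooth functions with bounded support
which almost realize the perimeter. -/
theorem exists_contDiff_bounded_approx_of_PeT {m : ℕ} {c : ℝ≥0∞} (hc0 : c ≠ 0) (hct : c ≠ ∞)
    (hc : (μH[(m : ℝ)] : Measure (Eucl m)) = c • volume) {E : Set (Eucl (m + 1))}
    (hE : PeT E ≠ ∞) {R : ℝ} (hR : 0 < R) (hER : E ⊆ ball 0 R)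
    {ε : ℝ≥0∞} (hε : ε ≠ 0) (hεt : ε ≠ ∞) :
    ∃ u : Eucl (m + 1) → ℝ, ContDiff ℝ (⊤ : ℕ∞) u ∧
      (∀ x, x ∉ closedBall (0 : Eucl (m + 1)) (R + 1) → u x = 0) ∧
      c * ∫⁻ x, ‖fderiv ℝ u x‖ₑ ≤ PeT E + ε ∧ ∫⁻ x, ‖u x - E.indicator 1 x‖ₑ ≤ ε := by
  set η : ContDiffBump (0 : Eucl (m + 1)) := ⟨R, R + 1, hR, lt_add_one R⟩ with hη
  have hηd : ContDiff ℝ (⊤ : ℕ∞) η := η.contDiff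
  obtain ⟨K, hK⟩ : ∃ K : ℝ, ∀ x, ‖fderiv ℝ η x‖ ≤ K :=
    (hηd.continuous_fderiv (by simp)).bounded_above_of_compact_support
      (η.hasCompactSupport.fderiv ℝ)
  set ε' := ε / (1 + c * ENNReal.ofReal K) with hε'
  have hden : 1 + c * ENNReal.ofReal K ≠ ∞ :=
    ENNReal.add_ne_top.2 ⟨ENNReal.one_ne_top, ENNReal.mul_ne_top hct ENNReal.ofReal_ne_top⟩
  have hεε : ε' * (1 + c * ENNReal.ofReal K) = ε :=
    ENNReal.div_mul_cancel (by simp) hden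
  have hε'0 : ε' ≠ 0 := ENNReal.div_ne_zero.2 ⟨hε, hden⟩
  have hε'le : ε' ≤ ε := by
    rw [← hεε]
    exact le_mul_of_one_le_right' le_self_add
  obtain ⟨w, hw, hw1, hw2⟩ := exists_contDiff_approx_of_PeT hc0 hct hc hE hε'0
    (ne_top_of_le_ne_top hεt hε'le)
  have hη1 : ∀ x ∈ ball (0 : Eucl (m + 1)) R, η x = 1 := fun x hx =>
    η.one_of_mem_closedBall (ball_subset_closedBall hx)
  have hpt : ∀ x, ‖fderiv ℝ (fun x => w x * η x) x‖ₑ ≤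
      ‖fderiv ℝ w x‖ₑ + ENNReal.ofReal K * ‖w x - E.indicator 1 x‖ₑ := by
    intro x
    have h1 := ((hw.differentiable (by simp)) x).hasFDerivAt.mul
      ((hηd.differentiable (by simp)) x).hasFDerivAt
    have h2 : ‖w x • fderiv ℝ η x‖ₑ ≤ ENNReal.ofReal K * ‖w x - E.indicator 1 x‖ₑ := by
      by_cases hx : x ∈ ball (0 : Eucl (m + 1)) R
      · have h3 : (η : Eucl (m + 1) → ℝ) =ᶠ[𝓝 x] fun _ => 1 :=
          eventually_of_mem (isOpen_ball.mem_nhds hx) hη1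
        rw [h3.fderiv_eq, fderiv_fun_const, Pi.zero_apply, smul_zero, ← ofReal_norm, norm_zero,
          ENNReal.ofReal_zero]
        exact zero_le
      · rw [indicator_of_notMem (fun h => hx (hER h)), sub_zero, enorm_smul, mul_comm]
        refine mul_le_mul' ?_ le_rfl
        rw [← ofReal_norm]
        exact ENNReal.ofReal_le_ofReal (hK x)
    have h4 : ‖η x • fderiv ℝ w x‖ₑ ≤ ‖fderiv ℝ w x‖ₑ := by
      rw [enorm_smul, Real.enorm_eq_ofReal η.nonneg]
      exact mul_le_of_le_one_left' (by simpa using η.le_one)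
    rw [show (fun x => w x * η x) = w * ⇑η from rfl, h1.fderiv,
      add_comm (w x • _)]
    refine le_trans ?_ (add_le_add h4 h2)
    rw [← ofReal_norm, ← ofReal_norm, ← ofReal_norm,
      ← ENNReal.ofReal_add (norm_nonneg _) (norm_nonneg _)]
    exact ENNReal.ofReal_le_ofReal (norm_add_le _ _)
  refine ⟨fun x => w x * η x, hw.mul hηd, fun x hx => ?_, ?_, ?_⟩
  · beta_reduce
    rw [η.zero_of_le_dist (le_of_lt (by simpa using hx)), mul_zero]
  · calc c * ∫⁻ x, ‖fderiv ℝ (fun x => w x * η x) x‖ₑ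
        ≤ c * ∫⁻ x, (‖fderiv ℝ w x‖ₑ + ENNReal.ofReal K * ‖w x - E.indicator 1 x‖ₑ) :=
          mul_le_mul' le_rfl (lintegral_mono hpt)
      _ = c * (∫⁻ x, ‖fderiv ℝ w x‖ₑ) +
            c * ENNReal.ofReal K * ∫⁻ x, ‖w x - E.indicator 1 x‖ₑ := by
          rw [lintegral_add_left, lintegral_const_mul' _ _ ENNReal.ofReal_ne_top, mul_add,
            mul_assoc]
          exact (hw.continuous_fderiv (by simp)).measurable.enorm
      _ ≤ PeT E + ε' + c * ENNReal.ofReal K * ε' := add_le_add hw1 (mul_le_mul' le_rfl hw2)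
      _ = PeT E + ε := by
          rw [← hεε]
          ring
  · refine le_trans (lintegral_mono fun x => ?_) (hw2.trans hε'le)
    beta_reduce
    by_cases hx : x ∈ E
    · rw [hη1 x (hER hx), mul_one]
    · rw [indicator_of_notMem hx, sub_zero, sub_zero, enorm_mul, Real.enorm_eq_ofReal η.nonneg]
      exact mul_le_of_le_one_right' (by simpa using η.le_one)

/-- Half of the sum of `u`, `v` and a signed smooth approximation of `|u - v|`: for `σ = 1` this
approximates `max u v`, for `σ = -1` it approximates `min u v`. -/
def smoothLattice {X : Type*} (δ σ : ℝ) (u v : X → ℝ) (x : X) : ℝ :=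
  (u x + v x + σ * (√((u x - v x) ^ 2 + δ ^ 2) - δ)) / 2

theorem abs_sqrt_sq_add_sq_sub_abs_le {δ : ℝ} (hδ : 0 ≤ δ) (a : ℝ) :
    abs (√(a ^ 2 + δ ^ 2) - δ - |a|) ≤ δ := by
  have h1 : √(a ^ 2 + δ ^ 2) ≤ |a| + δ :=
    Real.sqrt_le_iff.2 ⟨by positivity, by nlinarith [abs_nonneg a, sq_abs a]⟩
  have h2 : |a| ≤ √(a ^ 2 + δ ^ 2) := Real.le_sqrt_of_sq_le (by nlinarith [sq_abs a])
  rw [abs_le]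
  constructor <;> linarith

theorem abs_smoothLattice_one_sub_max_le {X : Type*} {δ : ℝ} (hδ : 0 ≤ δ) (u v : X → ℝ) (x : X) :
    |smoothLattice δ 1 u v x - max (u x) (v x)| ≤ δ := by
  have h := abs_le.1 (abs_sqrt_sq_add_sq_sub_abs_le hδ (u x - v x))
  rw [abs_le, smoothLattice]
  rcases le_total (u x) (v x) with h' | h'
  · rw [max_eq_right h']
    rw [abs_of_nonpos (sub_nonpos.2 h')] at h
    constructor <;> linarith [h.1, h.2]
  · rw [max_eq_left h']
    rw [abs_of_nonneg (sub_nonneg.2 h')] at h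
    constructor <;> linarith [h.1, h.2]

theorem abs_smoothLattice_neg_one_sub_min_le {X : Type*} {δ : ℝ} (hδ : 0 ≤ δ) (u v : X → ℝ)
    (x : X) : |smoothLattice δ (-1) u v x - min (u x) (v x)| ≤ δ := by
  have h := abs_le.1 (abs_sqrt_sq_add_sq_sub_abs_le hδ (u x - v x))
  rw [abs_le, smoothLattice]
  rcases le_total (u x) (v x) with h' | h'
  · rw [min_eq_left h']
    rw [abs_of_nonpos (sub_nonpos.2 h')] at h
    constructor <;> linarith [h.1, h.2]
  · rw [min_eq_right h']
    rw [abs_of_nonneg (sub_nonneg.2 h')] at h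
    constructor <;> linarith [h.1, h.2]

theorem smoothLattice_eq_zero {X : Type*} {δ : ℝ} (hδ : 0 ≤ δ) (σ : ℝ) {u v : X → ℝ} {x : X}
    (hu : u x = 0) (hv : v x = 0) : smoothLattice δ σ u v x = 0 := by
  simp [smoothLattice, hu, hv, Real.sqrt_sq hδ]

theorem ContDiff.smoothLattice {E : Type*} [NormedAddCommGroup E] [NormedSpace ℝ E] {δ : ℝ}
    (hδ : 0 < δ) (σ : ℝ) {u v : E → ℝ} {n : WithTop ℕ∞} (hu : ContDiff ℝ n u)
    (hv : ContDiff ℝ n v) : ContDiff ℝ n (smoothLattice δ σ u v) := by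
  have h1 : ContDiff ℝ n fun x => √((u x - v x) ^ 2 + δ ^ 2) :=
    (((hu.sub hv).pow 2).add contDiff_const).sqrt fun x => by positivity
  exact ((hu.add hv).add (contDiff_const.mul (h1.sub contDiff_const))).div_const 2

theorem enorm_fderiv_smoothLattice_add_le {E : Type*} [NormedAddCommGroup E] [NormedSpace ℝ E]
    {δ : ℝ} (hδ : 0 < δ) {u v : E → ℝ} {x : E} (hu : DifferentiableAt ℝ u x)
    (hv : DifferentiableAt ℝ v x) :
    ‖fderiv ℝ (smoothLattice δ 1 u v) x‖ₑ + ‖fderiv ℝ (smoothLattice δ (-1) u v) x‖ₑ ≤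
      ‖fderiv ℝ u x‖ₑ + ‖fderiv ℝ v x‖ₑ := by
  set q := √((u x - v x) ^ 2 + δ ^ 2) with hq
  have hq0 : 0 < q := Real.sqrt_pos.2 (by positivity)
  set s := (u x - v x) / q with hs
  have hs1 : |s| ≤ 1 := by
    rw [hs, abs_div, abs_of_pos hq0, div_le_one hq0]
    exact Real.abs_le_sqrt (by nlinarith)
  have hd : ∀ σ : ℝ, fderiv ℝ (smoothLattice δ σ u v) x =
      ((1 + σ * s) / 2) • fderiv ℝ u x + ((1 - σ * s) / 2) • fderiv ℝ v x := by
    intro σ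
    have h1 := (((hu.hasFDerivAt.fun_sub hv.hasFDerivAt).pow 2).add_const (δ ^ 2)).sqrt
      (by positivity : (u x - v x) ^ 2 + δ ^ 2 ≠ 0)
    have h2 := ((hu.hasFDerivAt.fun_add hv.hasFDerivAt).fun_add
      ((h1.sub_const δ).const_mul σ)).mul_const (2⁻¹ : ℝ)
    have h3 : HasFDerivAt (smoothLattice δ σ u v) _ x := h2
    rw [h3.fderiv]
    ext y
    simp [← hq, hs]
    field_simp
    ring
  have hs2 := abs_le.1 hs1
  rw [hd, hd]
  simp only [← ofReal_norm]
  rw [← ENNReal.ofReal_add (norm_nonneg _) (norm_nonneg _),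
    ← ENNReal.ofReal_add (norm_nonneg _) (norm_nonneg _)]
  refine ENNReal.ofReal_le_ofReal ?_
  have hb : ∀ σ : ℝ, |σ * s| ≤ 1 → ‖((1 + σ * s) / 2) • fderiv ℝ u x +
      ((1 - σ * s) / 2) • fderiv ℝ v x‖ ≤
        (1 + σ * s) / 2 * ‖fderiv ℝ u x‖ + (1 - σ * s) / 2 * ‖fderiv ℝ v x‖ := by
    intro σ hσ
    have hσ' := abs_le.1 hσ
    refine (norm_add_le _ _).trans_eq ?_
    rw [norm_smul, norm_smul, Real.norm_of_nonneg (by linarith), Real.norm_of_nonneg (by linarith)]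
  have h1 := hb 1 (by simpa using hs1)
  have h2 := hb (-1) (by simpa using hs1)
  linarith

theorem abs_max_sub_max_indicator_le {X : Type*} (E F : Set X) (a b : ℝ) (x : X) :
    |max a b - (E ∪ F).indicator 1 x| ≤ |a - E.indicator 1 x| + |b - F.indicator 1 x| := by
  have h1 : (E ∪ F).indicator (1 : X → ℝ) x = max (E.indicator 1 x) (F.indicator 1 x) := by
    by_cases hE : x ∈ E <;> by_cases hF : x ∈ F <;> simp [hE, hF]
  rw [h1]
  exact (abs_max_sub_max_le_max _ _ _ _).trans
    (max_le_add_of_nonneg (abs_nonneg _) (abs_nonneg _))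

theorem abs_min_sub_min_indicator_le {X : Type*} (E F : Set X) (a b : ℝ) (x : X) :
    |min a b - (E ∩ F).indicator 1 x| ≤ |a - E.indicator 1 x| + |b - F.indicator 1 x| := by
  have h1 : (E ∩ F).indicator (1 : X → ℝ) x = min (E.indicator 1 x) (F.indicator 1 x) := by
    by_cases hE : x ∈ E <;> by_cases hF : x ∈ F <;> simp [hE, hF]
  rw [h1]
  exact (abs_min_sub_min_le_max _ _ _ _).trans
    (max_le_add_of_nonneg (abs_nonneg _) (abs_nonneg _))

/-- Two bounded sets of finite perimeter admit `C¹` approximations of their union and intersection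
with controlled total boundary area. -/
theorem exists_hasC1Boundary_union_inter {m : ℕ} {c : ℝ≥0∞} (hc0 : c ≠ 0) (hct : c ≠ ∞)
    (hc : (μH[(m : ℝ)] : Measure (Eucl m)) = c • volume) {E F : Set (Eucl (m + 1))}
    (hEm : MeasurableSet E) (hFm : MeasurableSet F) (hE : PeT E ≠ ∞) (hF : PeT F ≠ ∞) {R : ℝ}
    (hR : 0 < R) (hER : E ⊆ ball 0 R) (hFR : F ⊆ ball 0 R) {τ : ℝ} (hτ0 : 0 < τ)
    (hτ1 : τ < 1 / 2) :
    ∃ C D : Set (Eucl (m + 1)), HasC1Boundary C ∧ HasC1Boundary D ∧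
      volume (C ∆ (E ∪ F)) ≤ ENNReal.ofReal τ ∧ volume (D ∆ (E ∩ F)) ≤ ENNReal.ofReal τ ∧
      ENNReal.ofReal (1 - 2 * τ) *
          (μH[(m : ℝ)] (frontier C) + μH[(m : ℝ)] (frontier D)) ≤
        ENNReal.ofReal (1 + τ) * (PeT E + PeT F + (2 + 2 * c) * ENNReal.ofReal τ) := by
  set B := closedBall (0 : Eucl (m + 1)) (R + 1) with hB
  set ε := ENNReal.ofReal (min τ (τ ^ 2 / 6)) with hε
  have hε0 : ε ≠ 0 := by
    rw [hε, Ne, ENNReal.ofReal_eq_zero, not_le]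
    positivity
  have hετ : ε ≤ ENNReal.ofReal τ := ENNReal.ofReal_le_ofReal (min_le_left _ _)
  have hε3 : ε + ε + ε ≤ ENNReal.ofReal (τ / 2) * ENNReal.ofReal τ := by
    rw [hε, ← ENNReal.ofReal_add (by positivity) (by positivity),
      ← ENNReal.ofReal_add (by positivity) (by positivity), ← ENNReal.ofReal_mul (by positivity)]
    refine ENNReal.ofReal_le_ofReal ?_
    nlinarith [min_le_right τ (τ ^ 2 / 6)]
  obtain ⟨δ, hδ0, hδ⟩ := ENNReal.exists_nnreal_pos_mul_lt
    (measure_closedBall_lt_top (μ := volume) (x := (0 : Eucl (m + 1))) (r := R + 1)).ne hε0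
  have hδ0' : (0 : ℝ) < δ := NNReal.coe_pos.2 hδ0
  obtain ⟨u, hu, huB, hu1, hu2⟩ :=
    exists_contDiff_bounded_approx_of_PeT hc0 hct hc hE hR hER hε0 ENNReal.ofReal_ne_top
  obtain ⟨v, hv, hvB, hv1, hv2⟩ :=
    exists_contDiff_bounded_approx_of_PeT hc0 hct hc hF hR hFR hε0 ENNReal.ofReal_ne_top
  have hclose : ∀ (σ : ℝ) (G : Set (Eucl (m + 1))), G ⊆ ball 0 R →
      (∀ x, |smoothLattice δ σ u v x - G.indicator 1 x| ≤
        |u x - E.indicator 1 x| + |v x - F.indicator 1 x| + δ) →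
      ∫⁻ x, ‖smoothLattice δ σ u v x - G.indicator 1 x‖ₑ ≤
        ENNReal.ofReal (τ / 2) * ENNReal.ofReal τ := by
    intro σ G hG hσ
    have hpt : ∀ x, ‖smoothLattice δ σ u v x - G.indicator 1 x‖ₑ ≤ ‖u x - E.indicator 1 x‖ₑ +
        ‖v x - F.indicator 1 x‖ₑ + B.indicator (fun _ => (δ : ℝ≥0∞)) x := by
      intro x
      by_cases hx : x ∈ B
      · rw [indicator_of_mem hx, ← ENNReal.ofReal_coe_nnreal, ← ofReal_norm, ← ofReal_norm,
          ← ofReal_norm, ← ENNReal.ofReal_add (norm_nonneg _) (norm_nonneg _),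
          ← ENNReal.ofReal_add (add_nonneg (norm_nonneg _) (norm_nonneg _)) δ.coe_nonneg]
        exact ENNReal.ofReal_le_ofReal (hσ x)
      · have hxG : x ∉ G := fun h =>
          hx (ball_subset_closedBall.trans (closedBall_subset_closedBall (by linarith)) (hG h))
        rw [smoothLattice_eq_zero hδ0'.le σ (huB x hx) (hvB x hx), indicator_of_notMem hxG,
          sub_zero, enorm_zero]
        exact zero_le
    calc ∫⁻ x, ‖smoothLattice δ σ u v x - G.indicator 1 x‖ₑ
        ≤ ∫⁻ x, (‖u x - E.indicator 1 x‖ₑ + ‖v x - F.indicator 1 x‖ₑ +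
            B.indicator (fun _ => (δ : ℝ≥0∞)) x) := lintegral_mono hpt
      _ = (∫⁻ x, ‖u x - E.indicator 1 x‖ₑ) + (∫⁻ x, ‖v x - F.indicator 1 x‖ₑ) +
            δ * volume B := by
          rw [lintegral_add_right _ (measurable_const.indicator measurableSet_closedBall),
            lintegral_add_left, lintegral_indicator_const measurableSet_closedBall]
          exact (hu.continuous.measurable.sub (measurable_one.indicator hEm)).enorm
      _ ≤ ε + ε + ε := add_le_add (add_le_add hu2 hv2) hδ.le
      _ ≤ _ := hε3
  have hτ2 : ENNReal.ofReal (τ / 2) ≠ 0 := by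
    rw [Ne, ENNReal.ofReal_eq_zero, not_le]
    positivity
  have hsub : ∀ {G : Set (Eucl (m + 1))}, G ⊆ ball 0 R → G ⊆ ball 0 (R + 1) := fun h =>
    h.trans (ball_subset_ball (by linarith))
  obtain ⟨C, hC1, hC2, hC3⟩ := exists_hasC1Boundary_of_approx hc
    ((ContDiff.smoothLattice hδ0' 1 hu hv).of_le (WithTop.coe_le_coe.2 (le_top : (2 : ℕ∞) ≤ ⊤)))
    (fun x hx => smoothLattice_eq_zero hδ0'.le 1 (huB x hx) (hvB x hx)) (hEm.union hFm)
    (hsub (union_subset hER hFR)) hτ0 hτ1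
  obtain ⟨D, hD1, hD2, hD3⟩ := exists_hasC1Boundary_of_approx hc
    ((ContDiff.smoothLattice hδ0' (-1) hu hv).of_le (WithTop.coe_le_coe.2 (le_top : (2 : ℕ∞) ≤ ⊤)))
    (fun x hx => smoothLattice_eq_zero hδ0'.le (-1) (huB x hx) (hvB x hx)) (hEm.inter hFm)
    (hsub (inter_subset_left.trans hER)) hτ0 hτ1
  refine ⟨C, D, hC1, hD1, ?_, ?_, ?_⟩
  · refine (ENNReal.mul_le_mul_iff_right hτ2 ENNReal.ofReal_ne_top).1
      (hC2.trans (hclose 1 _ (union_subset hER hFR) fun x => ?_))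
    have h1 := abs_smoothLattice_one_sub_max_le hδ0'.le u v x
    have h2 := abs_max_sub_max_indicator_le E F (u x) (v x) x
    linarith [abs_sub_le (smoothLattice δ 1 u v x) (max (u x) (v x)) ((E ∪ F).indicator 1 x)]
  · refine (ENNReal.mul_le_mul_iff_right hτ2 ENNReal.ofReal_ne_top).1
      (hD2.trans (hclose (-1) _ (inter_subset_left.trans hER) fun x => ?_))
    have h1 := abs_smoothLattice_neg_one_sub_min_le hδ0'.le u v x
    have h2 := abs_min_sub_min_indicator_le E F (u x) (v x) x
    linarith [abs_sub_le (smoothLattice δ (-1) u v x) (min (u x) (v x)) ((E ∩ F).indicator 1 x)]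
  · have hgrad : (∫⁻ x, ‖fderiv ℝ (smoothLattice δ 1 u v) x‖ₑ) +
        (∫⁻ x, ‖fderiv ℝ (smoothLattice δ (-1) u v) x‖ₑ) ≤
          (∫⁻ x, ‖fderiv ℝ u x‖ₑ) + ∫⁻ x, ‖fderiv ℝ v x‖ₑ := by
      rw [← lintegral_add_left, ← lintegral_add_left]
      · exact lintegral_mono fun x => enorm_fderiv_smoothLattice_add_le hδ0'
          (hu.differentiable (by simp) x) (hv.differentiable (by simp) x)
      · exact (hu.continuous_fderiv (by simp)).measurable.enorm
      · exact ((ContDiff.smoothLattice hδ0' 1 hu hv).continuous_fderiv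
          (by simp)).measurable.enorm
    rw [mul_add]
    calc _ ≤ _ := add_le_add hC3 hD3
      _ = ENNReal.ofReal (1 + τ) * (c * ((∫⁻ x, ‖fderiv ℝ (smoothLattice δ 1 u v) x‖ₑ) +
            (∫⁻ x, ‖fderiv ℝ (smoothLattice δ (-1) u v) x‖ₑ)) + 2 * c * ENNReal.ofReal τ) := by
          ring
      _ ≤ ENNReal.ofReal (1 + τ) * (c * ((∫⁻ x, ‖fderiv ℝ u x‖ₑ) + ∫⁻ x, ‖fderiv ℝ v x‖ₑ) +
            2 * c * ENNReal.ofReal τ) := by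
          gcongr
      _ ≤ ENNReal.ofReal (1 + τ) * ((PeT E + ENNReal.ofReal τ) + (PeT F + ENNReal.ofReal τ) +
            2 * c * ENNReal.ofReal τ) := by
          rw [mul_add c]
          exact mul_le_mul' le_rfl (add_le_add (add_le_add (hu1.trans (add_le_add le_rfl hετ))
            (hv1.trans (add_le_add le_rfl hετ))) le_rfl)
      _ = _ := by ring

theorem liminf_add_liminf_le_liminf_add (f g : ℕ → ℝ≥0∞) :
    liminf f atTop + liminf g atTop ≤ liminf (fun j => f j + g j) atTop := by
  simp only [liminf_eq_iSup_iInf_of_nat]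
  rw [ENNReal.iSup_add_iSup_of_monotone]
  · exact iSup_mono fun n => le_iInf₂ fun i hi =>
      add_le_add (iInf₂_le i hi) (iInf₂_le i hi)
  · exact fun a b hab => biInf_mono fun i hi => hab.trans hi
  · exact fun a b hab => biInf_mono fun i hi => hab.trans hi

/-- Submodularity of the perimeter on bounded sets. -/
theorem PeT_union_add_PeT_inter_le {m : ℕ} {E F : Set (Eucl (m + 1))} (hEm : MeasurableSet E)
    (hFm : MeasurableSet F) (hE : PeT E ≠ ∞) (hF : PeT F ≠ ∞) {R : ℝ} (hER : E ⊆ ball 0 R)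
    (hFR : F ⊆ ball 0 R) : PeT (E ∪ F) + PeT (E ∩ F) ≤ PeT E + PeT F := by
  wlog hR : 0 < R generalizing R
  · exact this (hER.trans (ball_subset_ball (le_max_left R 1)))
      (hFR.trans (ball_subset_ball (le_max_left R 1))) (by positivity)
  obtain ⟨c, hc0, hct, hc⟩ := exists_hausdorffMeasure_eq_smul_volume m
  set τ : ℕ → ℝ := fun j => 1 / ((j : ℝ) + 1) / 4 with hτ
  have hτ0 : ∀ j, 0 < τ j := fun j => by positivity
  have hτ1 : ∀ j, τ j < 1 / 2 := fun j => by
    have : 1 / ((j : ℝ) + 1) ≤ 1 := by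
      rw [div_le_one (by positivity)]
      linarith [(Nat.cast_nonneg j : (0 : ℝ) ≤ j)]
    simp only [hτ]
    linarith
  have hτl : Tendsto τ atTop (𝓝 0) := by
    simpa [hτ] using (tendsto_one_div_add_atTop_nhds_zero_nat (𝕜 := ℝ)).div_const 4
  choose C D hC hD hCE hDE hCD using fun j =>
    exists_hasC1Boundary_union_inter hc0 hct hc hEm hFm hE hF hR hER hFR (hτ0 j) (hτ1 j)
  have hτl' : Tendsto (fun j => ENNReal.ofReal (τ j)) atTop (𝓝 0) := by
    simpa using ENNReal.tendsto_ofReal hτl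
  have hlim : Tendsto (fun j => ENNReal.ofReal (1 + τ j) *
      (PeT E + PeT F + (2 + 2 * c) * ENNReal.ofReal (τ j)) / ENNReal.ofReal (1 - 2 * τ j))
      atTop (𝓝 (PeT E + PeT F)) := by
    have h1 : Tendsto (fun j => ENNReal.ofReal (1 + τ j)) atTop (𝓝 1) := by
      simpa using ENNReal.tendsto_ofReal ((tendsto_const_nhds (x := (1 : ℝ))).add hτl)
    have h2 : Tendsto (fun j => ENNReal.ofReal (1 - 2 * τ j)) atTop (𝓝 1) := by
      simpa using ENNReal.tendsto_ofReal ((tendsto_const_nhds (x := (1 : ℝ))).sub (hτl.const_mul 2))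
    have h3 : Tendsto (fun j => PeT E + PeT F + (2 + 2 * c) * ENNReal.ofReal (τ j)) atTop
        (𝓝 (PeT E + PeT F)) := by
      have h4 : 2 + 2 * c ≠ ∞ :=
        ENNReal.add_ne_top.2 ⟨ENNReal.ofNat_ne_top, ENNReal.mul_ne_top ENNReal.ofNat_ne_top hct⟩
      simpa using tendsto_const_nhds.add (ENNReal.Tendsto.const_mul hτl' (Or.inr h4))
    simpa using ENNReal.Tendsto.div (ENNReal.Tendsto.mul h1 (Or.inl one_ne_zero) h3
      (Or.inr ENNReal.one_ne_top)) (Or.inr one_ne_zero) h2 (Or.inl ENNReal.one_ne_top)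
  have hle : ∀ j, μH[(m : ℝ)] (frontier (C j)) + μH[(m : ℝ)] (frontier (D j)) ≤
      ENNReal.ofReal (1 + τ j) * (PeT E + PeT F + (2 + 2 * c) * ENNReal.ofReal (τ j)) /
        ENNReal.ofReal (1 - 2 * τ j) := by
    intro j
    rw [ENNReal.le_div_iff_mul_le (Or.inl ?_) (Or.inl ENNReal.ofReal_ne_top), mul_comm]
    · exact hCD j
    · rw [Ne, ENNReal.ofReal_eq_zero, not_le]
      linarith [hτ1 j]
  have h1 := PeT_le_liminf hC (tendsto_of_tendsto_of_tendsto_of_le_of_le tendsto_const_nhds hτl'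
    (fun _ => zero_le) hCE)
  have h2 := PeT_le_liminf hD (tendsto_of_tendsto_of_tendsto_of_le_of_le tendsto_const_nhds hτl'
    (fun _ => zero_le) hDE)
  simp only [Nat.cast_add, Nat.cast_one, add_sub_cancel_right] at h1 h2
  calc PeT (E ∪ F) + PeT (E ∩ F) ≤ _ := add_le_add h1 h2
    _ ≤ liminf (fun j => μH[(m : ℝ)] (frontier (C j)) + μH[(m : ℝ)] (frontier (D j))) atTop :=
        liminf_add_liminf_le_liminf_add _ _
    _ ≤ _ := liminf_le_liminf (Eventually.of_forall hle)
    _ = _ := hlim.liminf_eq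

theorem PeT_congr_of_ae {n : ℕ} {E F : Set (Eucl n)} (h : E =ᵐ[volume] F) : PeT E = PeT F := by
  have hm : ∀ A : Set (Eucl n), volume (A ∆ E) = volume (A ∆ F) := fun A =>
    measure_congr ((ae_eq_refl A).symmDiff h)
  simp only [PeT, Pe, inter_univ, hm]

theorem PeT_eq_zero_of_dim_zero (E : Set (Eucl 0)) : PeT E = 0 := by
  have hE : HasC1Boundary E := fun x hx => by simp at hx
  have h := PeT_le_liminf (A := fun _ => E) (E := E) (fun _ => hE) (by simp)
  simpa using h

/-- Lower semicontinuity of the perimeter under `L¹` convergence. -/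
theorem PeT_le_of_tendsto {n : ℕ} {A : ℕ → Set (Eucl n)} {E : Set (Eucl n)} {M : ℝ≥0∞}
    (hA : ∀ k, PeT (A k) ≤ M) (hAE : Tendsto (fun k => volume (A k ∆ E)) atTop (𝓝 0)) :
    PeT E ≤ M := by
  rcases eq_or_ne M ∞ with rfl | hM
  · exact le_top
  have hε : Tendsto (fun k : ℕ => ((k : ℝ≥0∞) + 1)⁻¹) atTop (𝓝 0) := by
    simpa using (tendsto_add_atTop_iff_nat 1).2 ENNReal.tendsto_inv_nat_nhds_zero
  choose B hB hBA hBM using fun k : ℕ => exists_hasC1Boundary_le_PeT_add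
    (ne_top_of_le_ne_top hM (hA k)) (ε := ((k : ℝ≥0∞) + 1)⁻¹) (by simp)
  have hBE : Tendsto (fun k => volume (B k ∆ E)) atTop (𝓝 0) := by
    refine tendsto_of_tendsto_of_tendsto_of_le_of_le tendsto_const_nhds
      (by simpa using hε.add hAE) (fun _ => zero_le) fun k => ?_
    exact (measure_symmDiff_le _ (A k) _).trans (add_le_add (hBA k) le_rfl)
  refine (PeT_le_liminf hB hBE).trans ?_
  have hlim : Tendsto (fun k : ℕ => M + ((k : ℝ≥0∞) + 1)⁻¹) atTop (𝓝 M) := by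
    simpa using tendsto_const_nhds.add hε
  rw [← hlim.liminf_eq]
  exact liminf_le_liminf (Eventually.of_forall fun k =>
    (hBM k).trans (add_le_add (hA k) le_rfl))

theorem measure_diff_eq_zero_of_tendsto_symmDiff {X : Type*} [MeasurableSpace X] {μ : Measure X}
    {A : ℕ → Set X} {E S : Set X} (hA : ∀ k, A k ⊆ S)
    (hAE : Tendsto (fun k => μ (A k ∆ E)) atTop (𝓝 0)) : μ (E \ S) = 0 :=
  le_antisymm (ge_of_tendsto' hAE fun k => measure_mono fun _ hx =>
    Or.inr ⟨hx.1, fun h => hx.2 (hA k h)⟩) zero_le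

theorem PeT_inter_le_of_isMinimizingHull {m : ℕ} {E F : Set (Eucl (m + 1))} {R : ℝ}
    (hE : IsMinimizingHull E) (hEc : IsCaccioppoli E) (hER : E ⊆ ball 0 R)
    (hF : MeasurableSet F) (hFR : F ⊆ ball 0 R) : PeT (F ∩ E) ≤ PeT F := by
  rcases eq_or_ne (PeT F) ∞ with hFt | hFt
  · exact hFt ▸ le_top
  have h1 : PeT E ≤ PeT (F ∪ E) := hE _ (hF.union hEc.1) subset_union_right
    (isBounded_ball.subset (sdiff_subset.trans (union_subset hFR hER)))
  have h2 := PeT_union_add_PeT_inter_le hF hEc.1 hFt hEc.2.ne hFR hER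
  rw [add_comm (PeT F)] at h2
  exact (ENNReal.add_le_add_iff_left hEc.2.ne).1 ((add_le_add h1 le_rfl).trans h2)

/-- An `L¹`-limit of minimizing hulls (all contained in a fixed ball) is a minimizing
hull. -/
theorem minimizing_hull_limit (n : ℕ) (R : ℝ) (Ek : ℕ → Set (Eucl n)) (E : Set (Eucl n))
    (hsub : ∀ k, Ek k ⊆ ball 0 R) (hcac : ∀ k, IsCaccioppoli (Ek k))
    (hhull : ∀ k, IsMinimizingHull (Ek k)) (hEm : MeasurableSet E)
    (hconv : Tendsto (fun k => volume ((Ek k) ∆ E)) atTop (nhds 0)) :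
    IsMinimizingHull E := by
  intro F hF hEF hFE
  obtain _ | m := n
  · simp [PeT_eq_zero_of_dim_zero]
  obtain ⟨R', hR', hFR'⟩ : ∃ R', R ≤ R' ∧ F \ E ⊆ ball 0 R' := by
    obtain ⟨r, hr⟩ := hFE.subset_ball (0 : Eucl (m + 1))
    exact ⟨max R r, le_max_left _ _, hr.trans (ball_subset_ball (le_max_right _ _))⟩
  have hnull : volume (E \ ball 0 R') = 0 :=
    measure_diff_eq_zero_of_tendsto_symmDiff
      (fun k => (hsub k).trans (ball_subset_ball hR')) hconv
  have hFG : (F ∩ ball 0 R' : Set (Eucl (m + 1))) =ᵐ[volume] F := by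
    refine inter_subset_left.eventuallyLE.antisymm (ae_le_set.2 (measure_mono_null ?_ hnull))
    exact fun x hx => ⟨by_contra fun h => hx.2 ⟨hx.1, hFR' ⟨hx.1, h⟩⟩, fun h => hx.2 ⟨hx.1, h⟩⟩
  rw [← PeT_congr_of_ae hFG]
  have hFm : MeasurableSet (F ∩ ball 0 R') := hF.inter measurableSet_ball
  refine PeT_le_of_tendsto (A := fun k => F ∩ ball 0 R' ∩ Ek k)
    (fun k => PeT_inter_le_of_isMinimizingHull (hhull k) (hcac k)
      ((hsub k).trans (ball_subset_ball hR')) hFm inter_subset_right) ?_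
  refine tendsto_of_tendsto_of_tendsto_of_le_of_le tendsto_const_nhds hconv
    (fun _ => zero_le) fun k => ?_
  rw [← add_zero (volume (Ek k ∆ E)), ← hnull]
  refine (measure_mono fun x hx => ?_).trans (measure_union_le _ _)
  rcases hx with ⟨hx, hxE⟩ | ⟨hxE, hx⟩
  · exact Or.inl (Or.inl ⟨hx.2, hxE⟩)
  · by_cases hb : x ∈ ball 0 R'
    · exact Or.inl (Or.inr ⟨hxE, fun h => hx ⟨⟨hEF hxE, hb⟩, h⟩⟩)
    · exact Or.inr ⟨hxE, hb⟩
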